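/- arXiv:1709.02880 — 3 statements merged into one kernel-verified Lean document; each statement's English description precedes it below -/
import Mathlib

section
/- Let n ∈ {2,3}, let U_k^j be the singular-value in-approximation sets for O(n), and let M ∈ ℝ^{n×n} with σ_n(M) < 1 and M ∈ U_k^j for some k ∈ ℕ and j ∈ {0,1,…,n−1}. Set δ = κ₀·2^{−10}/n with κ₀ = 1/4. Then there exist a diamond Ω^⋄ of aspect ratio 1:δ (if n = 2) or 1:δ:1 (if n = 3), a piecewise affine map w : Ω^⋄ → ℝⁿ, a measurable set (Ω^⋄)_g^★ ⊂ Ω^⋄, and a constant C ≥ 1 independent of k, j and M, such that: (i) ∇w(x) ∈ U_k^{j+1} for a.e. x ∈ Ω^⋄; (ii) |∇w(x) − M| ≤ C·2^{−k} for a.e. x ∈ (Ω^⋄)_g^★; (iii) w(x) = Mx for x ∈ ∂Ω^⋄; (iv) |(Ω^⋄)_g^★| ≥ (1 − C·2^{−k})|Ω^⋄|; (v) the level sets Ω₁,…,Ω_N of ∇w satisfy Σ_{i=1}^{N} Per(Ω_i) ≤ 2^{n+2} Per(Ω^⋄). -/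
noncomputable section
open MeasureTheory Set ENNReal Matrix

abbrev Euc (n : ℕ) := EuclideanSpace ℝ (Fin n)
abbrev Mat (n : ℕ) := Matrix (Fin n) (Fin n) ℝ

/-- The Frobenius norm of a matrix. -/
def frobNorm {n : ℕ} (A : Mat n) : ℝ := Real.sqrt (∑ i, ∑ j, (A i j) ^ 2)

/-- The continuous linear map on Euclidean space induced by a matrix. -/
def matCLM {n : ℕ} (A : Mat n) : Euc n →L[ℝ] Euc n :=
  LinearMap.toContinuousLinearMap (Matrix.toEuclideanLin A)

/-- A matrix applied to a vector in Euclidean space. -/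
def matVec {n : ℕ} (A : Mat n) (x : Euc n) : Euc n := matCLM A x

/-- The operator norm of a matrix, i.e. its largest singular value σ_n. -/
def matOpNorm {n : ℕ} (A : Mat n) : ℝ := ‖matCLM A‖

/-- `c_k = 1 − 3·2^{−(k+2)}`. -/
def ck (k : ℕ) : ℝ := 1 - 3 * (1/2 : ℝ) ^ (k + 2)

/-- `d_k = 2^{−(k+2)}`. -/
def dk (k : ℕ) : ℝ := (1/2 : ℝ) ^ (k + 2)

/-- The interval `I_{k,κ} = [c_k − κ d_k, c_k + κ d_k]`. -/
def Iset (k : ℕ) (κ : ℝ) : Set ℝ := Set.Icc (ck k - κ * dk k) (ck k + κ * dk k)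

/-- `M` has the same singular values as `D` (via a singular value decomposition). -/
def sameSingular {n : ℕ} (M D : Mat n) : Prop :=
  ∃ V₁ V₂ : Mat n, V₁ᵀ * V₁ = 1 ∧ V₂ᵀ * V₂ = 1 ∧ M = V₁ * D * V₂

/-- The set `U_k^j` of the in-approximation for O(n) (with `κ₀ = 1/4`). -/
def Uset (n k j : ℕ) : Set (Mat n) :=
  {M | ∃ μ : Fin n → ℝ, sameSingular M (Matrix.diagonal μ) ∧
    (∀ i : Fin n, (i : ℕ) < j → μ i ∈ Iset k ((1/4 : ℝ) * j / n)) ∧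
    (∀ i : Fin n, j ≤ (i : ℕ) → μ i ∈ Iset (k - 1) ((1/4 : ℝ) * (1 + (j : ℝ) / n)))}

/-- The vertices `±e₁, ±δe₂ (, ±e₃)` of the model diamond. -/
def diamondVertices (n : ℕ) (δ : ℝ) : Set (Euc n) :=
  {v | ∃ i : Fin n, v = (if (i : ℕ) = 1 then δ else 1) • EuclideanSpace.single i (1 : ℝ) ∨
       v = -((if (i : ℕ) = 1 then δ else 1) • EuclideanSpace.single i (1 : ℝ))}

/-- The model diamond `conv{±e₁, ±δe₂ (, ±e₃)}`. -/
def baseDiamond (n : ℕ) (δ : ℝ) : Set (Euc n) := convexHull ℝ (diamondVertices n δ)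

/-- A diamond of aspect ratio `1:δ` (resp. `1:δ:1`). -/
def IsDiamond (n : ℕ) (δ : ℝ) (Ω : Set (Euc n)) : Prop :=
  ∃ (x₀ : Euc n) (r : ℝ) (Q : Mat n), 0 < r ∧ Qᵀ * Q = 1 ∧ Q.det = 1 ∧
    Ω = (fun y => x₀ + r • matVec Q y) '' baseDiamond n δ

/-- A continuous map which is affine on each polytope of a finite cover of `Ω`. -/
def IsPiecewiseAffine {n : ℕ} (Ω : Set (Euc n)) (u : Euc n → Euc n) : Prop :=
  ContinuousOn u Ω ∧ ∃ (N : ℕ) (P : Fin N → Set (Euc n)),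
    (∀ i, ∃ S : Finset (Euc n), P i = convexHull ℝ (S : Set (Euc n))) ∧
    Ω ⊆ ⋃ i, P i ∧
    (∀ i, ∃ (f : Euc n →ₗ[ℝ] Euc n) (b : Euc n), ∀ x ∈ P i ∩ Ω, u x = f x + b)

/-- The perimeter of a set: the (n−1)-dimensional Hausdorff measure of its boundary. -/
def Per {n : ℕ} (E : Set (Euc n)) : ℝ := (μH[(n : ℝ) - 1] (frontier E)).toReal

/-- A ray starting in a bounded set meets the frontier of that set. -/
theorem exists_ray_mem_frontier {E : Type*} [NormedAddCommGroup E] [NormedSpace ℝ E]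
    {L : Set E} (hL : Bornology.IsBounded L) {y v : E} (hy : y ∈ L) (hv : v ≠ 0) :
    ∃ t : ℝ, 0 ≤ t ∧ y + t • v ∈ frontier L := by
  by_contra! h
  have hc : Continuous fun t : ℝ => y + |t| • v := by fun_prop
  have he : frontier ((fun t : ℝ => y + |t| • v) ⁻¹' L) = ∅ := by
    refine Set.subset_empty_iff.1 fun t ht => ?_
    exact h |t| (abs_nonneg t) (hc.frontier_preimage_subset L ht)
  have hall : ((fun t : ℝ => y + |t| • v) ⁻¹' L) = univ := by
    rcases frontier_eq_empty_iff.1 he with h0 | h1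
    · have : (0 : ℝ) ∈ ((fun t : ℝ => y + |t| • v) ⁻¹' L) := by simpa using hy
      simp [h0] at this
    · exact h1
  obtain ⟨R, hR⟩ := hL.exists_norm_le
  have hvp : 0 < ‖v‖ := norm_pos_iff.2 hv
  have hyR := hR y hy
  have hRn : 0 ≤ R := (norm_nonneg y).trans hyR
  have hmem : (2 * R + 1) / ‖v‖ ∈ ((fun t : ℝ => y + |t| • v) ⁻¹' L) := by
    rw [hall]; trivial
  have h1 := hR _ hmem
  have h2 : ‖|(2 * R + 1) / ‖v‖| • v‖ = 2 * R + 1 := by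
    rw [norm_smul, Real.norm_eq_abs, abs_abs, abs_of_nonneg (by positivity)]
    field_simp
  have h3 := norm_sub_le (y + |(2 * R + 1) / ‖v‖| • v) y
  rw [add_sub_cancel_left, h2] at h3
  linarith

/-- In finite dimension a convex set and its closure have the same interior. -/
theorem Convex.interior_closure_eq_of_finiteDimensional {E : Type*} [NormedAddCommGroup E]
    [NormedSpace ℝ E] [FiniteDimensional ℝ E] {K : Set E} (hK : Convex ℝ K) :
    interior (closure K) = interior K := by
  by_cases h : (interior K).Nonempty
  · exact hK.interior_closure_eq_interior_of_nonempty_interior h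
  · refine Set.Subset.antisymm (fun x hx => ?_) (interior_mono subset_closure)
    exfalso
    apply h
    rw [hK.interior_nonempty_iff_affineSpan_eq_top]
    have h1 := (hK.closure.interior_nonempty_iff_affineSpan_eq_top).1 ⟨x, hx⟩
    rw [← top_le_iff, ← h1, affineSpan_le]
    exact closure_minimal (subset_affineSpan ℝ K) (AffineSubspace.closed_of_finiteDimensional _)

/-- The Hausdorff measure of the frontier is monotone among bounded convex sets. -/
theorem Convex.hausdorffMeasure_frontier_mono {E : Type*} [NormedAddCommGroup E]
    [InnerProductSpace ℝ E] [FiniteDimensional ℝ E] [MeasurableSpace E] [BorelSpace E]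
    {K L : Set E} (hK : Convex ℝ K) (hKL : K ⊆ L) (hLc : IsClosed L)
    (hL : Bornology.IsBounded L) {d : ℝ} (hd : 0 ≤ d) :
    μH[d] (frontier K) ≤ μH[d] (frontier L) := by
  rcases K.eq_empty_or_nonempty with rfl | hne
  · simp
  have hKc : Convex ℝ (closure K) := hK.closure
  have hex : ∀ u : E, ∃ v ∈ closure K, ∀ w ∈ closure K, inner ℝ (u - v) (w - v) ≤ 0 := by
    intro u
    obtain ⟨v, hv, h⟩ := exists_norm_eq_iInf_of_complete_convex hne.closure
      isClosed_closure.isComplete hKc u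
    exact ⟨v, hv, (norm_eq_iInf_iff_real_inner_le_zero hKc hv).1 h⟩
  choose π hπ hin using hex
  have huniq : ∀ u v, v ∈ closure K → (∀ w ∈ closure K, inner ℝ (u - v) (w - v) ≤ 0) → π u = v := by
    intro u v hv h
    have h1 := h _ (hπ u)
    have h2 := hin u v hv
    have h3 : inner ℝ (π u - v) (π u - v) ≤ 0 := by
      have : inner ℝ (π u - v) (π u - v)
          = inner ℝ (u - v) (π u - v) + inner ℝ (u - π u) (v - π u) := by
        rw [← neg_sub (π u) v, inner_neg_right, ← sub_eq_add_neg, ← inner_sub_left]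
        congr 1; abel
      linarith
    rw [real_inner_self_eq_norm_sq] at h3
    exact sub_eq_zero.1 (norm_eq_zero.1 (pow_eq_zero_iff two_ne_zero |>.1
      (le_antisymm h3 (sq_nonneg _))))
  have hlip : LipschitzWith 1 π := by
    refine LipschitzWith.of_dist_le_mul fun u v => ?_
    rw [NNReal.coe_one, one_mul, dist_eq_norm, dist_eq_norm]
    have h1 := hin u _ (hπ v)
    have h2 := hin v _ (hπ u)
    have h3 : inner ℝ (π u - π v) (π u - π v) ≤ inner ℝ (u - v) (π u - π v) := by
      have : inner ℝ (u - v) (π u - π v) - inner ℝ (π u - π v) (π u - π v)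
          = - inner ℝ (u - π u) (π v - π u) - inner ℝ (v - π v) (π u - π v) := by
        rw [← neg_sub (π u) (π v), inner_neg_right, neg_neg, ← inner_sub_left, ← inner_sub_left]
        congr 1; abel
      linarith
    have h4 := real_inner_le_norm (u - v) (π u - π v)
    rw [real_inner_self_eq_norm_sq] at h3
    by_contra! h5
    nlinarith [norm_nonneg (u - v)]
  have hcl : closure K ⊆ L := closure_minimal hKL hLc
  have hcomp : IsCompact (frontier L) :=
    Metric.isCompact_of_isClosed_isBounded isClosed_frontier (hL.subset hLc.frontier_subset)
  have himg : IsClosed (π '' frontier L) := (hcomp.image hlip.continuous).isClosed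
  have hsub : frontier K ⊆ π '' frontier L := by
    intro x hx
    rw [← himg.closure_eq, Metric.mem_closure_iff]
    intro ε hε
    have hx2 : x ∉ interior (closure K) := by
      rw [hK.interior_closure_eq_of_finiteDimensional]; exact hx.2
    have hx3 : x ∈ closure (closure K)ᶜ := by rwa [closure_compl]
    obtain ⟨x', hx', hd'⟩ := Metric.mem_closure_iff.1 hx3 ε hε
    have hπx : π x = x := huniq x x hx.1 (by simp)
    have hne' : x' - π x' ≠ 0 := by
      intro h
      apply hx'
      rw [sub_eq_zero.1 h]; exact hπ x'
    obtain ⟨t, ht, hmem⟩ := exists_ray_mem_frontier hL (hcl (hπ x')) hne'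
    refine ⟨π (π x' + t • (x' - π x')), ⟨_, hmem, rfl⟩, ?_⟩
    rw [huniq (π x' + t • (x' - π x')) (π x') (hπ x')]
    · calc dist x (π x') = dist (π x) (π x') := by rw [hπx]
        _ ≤ dist x x' := by simpa using hlip.dist_le_mul x x'
        _ < ε := hd'
    · intro w hw
      rw [add_sub_cancel_left, real_inner_smul_left]
      exact mul_nonpos_of_nonneg_of_nonpos ht (hin x' w hw)
  calc μH[d] (frontier K) ≤ μH[d] (π '' frontier L) := measure_mono hsub
    _ ≤ ((1 : NNReal) : ℝ≥0∞) ^ d * μH[d] (frontier L) := hlip.hausdorffMeasure_image_le hd _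
    _ = μH[d] (frontier L) := by simp

/-- The frontier of a cube has finite codimension-one Hausdorff measure. -/
theorem hausdorffMeasure_frontier_cube_lt_top (m : ℕ) (R : ℝ) :
    μH[(m : ℝ)] (frontier {x : EuclideanSpace ℝ (Fin (m + 1)) | ∀ i, |x i| ≤ R}) < ∞ := by
  let F : Fin (m + 1) → ℝ → (Fin m → ℝ) → EuclideanSpace ℝ (Fin (m + 1)) :=
    fun i c y => WithLp.toLp 2 (i.insertNth c y)
  have hF : ∀ i c, μH[(m : ℝ)] (F i c '' Icc (fun _ => -R) (fun _ => R)) < ∞ := by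
    intro i c
    obtain ⟨K, hK⟩ : ∃ K, LipschitzWith K (F i c) := by
      refine ⟨_, (PiLp.lipschitzWith_toLp 2 (fun _ : Fin (m + 1) => ℝ)).comp
        (LipschitzWith.of_dist_le_mul (K := 1) fun y z => ?_)⟩
      rw [NNReal.coe_one, one_mul, dist_pi_le_iff dist_nonneg]
      intro j
      refine i.succAboveCases ?_ (fun l => ?_) j
      · simp
      · simpa using dist_le_pi_dist y z l
    refine (hK.hausdorffMeasure_image_le (Nat.cast_nonneg m) _).trans_lt ?_
    refine ENNReal.mul_lt_top (by simp) ?_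
    have := hausdorffMeasure_pi_real (ι := Fin m)
    rw [Fintype.card_fin] at this
    rw [this]
    exact isCompact_Icc.measure_lt_top
  have hcl : IsClosed {x : EuclideanSpace ℝ (Fin (m + 1)) | ∀ i, |x i| ≤ R} := by
    rw [Set.ofPred_forall]
    exact isClosed_iInter fun i => isClosed_le (by fun_prop) (by fun_prop)
  have hop : IsOpen {x : EuclideanSpace ℝ (Fin (m + 1)) | ∀ i, |x i| < R} := by
    rw [Set.ofPred_forall]
    exact isOpen_iInter_of_finite fun i => isOpen_lt (by fun_prop) (by fun_prop)
  have hsub : frontier {x : EuclideanSpace ℝ (Fin (m + 1)) | ∀ i, |x i| ≤ R} ⊆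
      ⋃ i : Fin (m + 1), ((F i R '' Icc (fun _ => -R) (fun _ => R)) ∪
        (F i (-R) '' Icc (fun _ => -R) (fun _ => R))) := by
    intro x hx
    have hxm : ∀ i, |x i| ≤ R := hcl.frontier_subset hx
    have hxn : ∃ i, R ≤ |x i| := by
      by_contra! h
      exact hx.2 (interior_maximal (fun y hy i => (hy i).le) hop h)
    obtain ⟨i, hi⟩ := hxn
    have hmem : (fun l => x (i.succAbove l)) ∈ Icc (fun _ : Fin m => -R) (fun _ => R) :=
      ⟨fun l => (abs_le.1 (hxm _)).1, fun l => (abs_le.1 (hxm _)).2⟩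
    have hre : ∀ c, x i = c → F i c (fun l => x (i.succAbove l)) = x := by
      intro c hc
      ext j
      refine i.succAboveCases ?_ (fun l => ?_) j
      · simp [F, hc]
      · simp [F]
    refine mem_iUnion.2 ⟨i, ?_⟩
    have hR := le_antisymm (hxm i) hi
    rcases abs_choice (x i) with h | h
    · exact Or.inl ⟨_, hmem, hre _ (by linarith)⟩
    · exact Or.inr ⟨_, hmem, hre _ (by linarith)⟩
  refine (measure_mono hsub).trans_lt ?_
  refine (measure_iUnion_fintype_le _ _).trans_lt ?_
  exact ENNReal.sum_lt_top.2 fun i _ =>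
    (measure_union_le _ _).trans_lt (ENNReal.add_lt_top.2 ⟨hF _ _, hF _ _⟩)

theorem frontier_finset_biUnion_subset {X ι : Type*} [TopologicalSpace X] (s : Finset ι)
    (f : ι → Set X) : frontier (⋃ i ∈ s, f i) ⊆ ⋃ i ∈ s, frontier (f i) := by
  intro x hx
  have h1 := hx.1
  rw [s.closure_biUnion f] at h1
  obtain ⟨i, hi, hxi⟩ := mem_iUnion₂.1 h1
  exact mem_iUnion₂.2 ⟨i, hi, hxi, fun h => hx.2 (interior_mono (subset_biUnion_of_mem hi) h)⟩

theorem matVec_apply {n : ℕ} (A : Mat n) (x : Euc n) (i : Fin n) :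
    matVec A x i = ∑ j, A i j * x j := rfl

theorem matVec_mul {n : ℕ} (A B : Mat n) (x : Euc n) :
    matVec (A * B) x = matVec A (matVec B x) := by
  ext i
  simp only [matVec_apply, Matrix.mul_apply, Finset.sum_mul, Finset.mul_sum]
  rw [Finset.sum_comm]
  simp only [mul_assoc]

theorem matVec_one {n : ℕ} (x : Euc n) : matVec (1 : Mat n) x = x := by
  ext i
  simp [matVec_apply, Matrix.one_apply]

theorem matVec_add {n : ℕ} (A B : Mat n) (x : Euc n) :
    matVec (A + B) x = matVec A x + matVec B x := by
  ext i
  simp [matVec_apply, add_mul, Finset.sum_add_distrib]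

/-- Finitely many linear functionals, fewer than the dimension, have a common nonzero zero. -/
theorem exists_ne_zero_forall_eq_zero {E ι : Type*} [AddCommGroup E] [Module ℝ E]
    [FiniteDimensional ℝ E] [Fintype ι] (f : ι → E →ₗ[ℝ] ℝ)
    (h : Fintype.card ι < Module.finrank ℝ E) : ∃ x : E, x ≠ 0 ∧ ∀ i, f i x = 0 := by
  have hk : LinearMap.ker (LinearMap.pi f) ≠ ⊥ :=
    LinearMap.ker_ne_bot_of_finrank_lt (by rwa [Module.finrank_fintype_fun_eq_card])
  obtain ⟨x, hx, hx0⟩ := Submodule.exists_mem_ne_zero_of_ne_bot hk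
  exact ⟨x, hx0, fun i => congr_fun (LinearMap.mem_ker.1 hx) i⟩

/-- Singular value decomposition of an injective square matrix, with antitone singular values. -/
theorem exists_singular_value_decomposition {n : ℕ} (A : Mat n)
    (hA : ∀ x : Euc n, x ≠ 0 → matVec A x ≠ 0) :
    ∃ (ν : Fin n → ℝ) (b : OrthonormalBasis (Fin n) ℝ (Euc n)), Antitone ν ∧ (∀ i, 0 < ν i) ∧
      sameSingular A (Matrix.diagonal ν) ∧
      ∀ x, ‖matVec A x‖ ^ 2 = ∑ i, ν i ^ 2 * (inner ℝ (b i) x) ^ 2 := by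
  have hn : Module.finrank ℝ (Euc n) = n := by simp
  set T : Euc n →ₗ[ℝ] Euc n := Matrix.toEuclideanLin A with hT
  have hTA : ∀ x, T x = matVec A x := fun x => rfl
  have hS := T.isSymmetric_adjoint_comp_self
  set b := hS.eigenvectorBasis hn with hb
  set ν : Fin n → ℝ := fun i => T.singularValues i with hν
  have hsq : ∀ i, ν i ^ 2 = hS.eigenvalues hn i := fun i => T.sq_singularValues_fin hn i
  have hin : ∀ x i, inner ℝ (T (b i)) (T x) = ν i ^ 2 * inner ℝ (b i) x := by
    intro x i
    rw [← LinearMap.adjoint_inner_left, ← LinearMap.comp_apply, hS.apply_eigenvectorBasis hn i,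
      inner_smul_left, hsq]
    rfl
  have hpos : ∀ i, 0 < ν i := by
    intro i
    refine lt_of_le_of_ne (T.singularValues_nonneg i) fun h0 => ?_
    have h1 := hin (b i) i
    rw [← h0] at h1
    refine hA (b i) (b.orthonormal.ne_zero i) ?_
    rw [← hTA]
    simpa using h1
  have hquad : ∀ x, ‖T x‖ ^ 2 = ∑ i, ν i ^ 2 * (inner ℝ (b i) x) ^ 2 := by
    intro x
    rw [← real_inner_self_eq_norm_sq]
    have hx : T x = ∑ i, inner ℝ (b i) x • T (b i) := by
      conv_lhs => rw [← b.sum_repr' x]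
      simp only [map_sum, map_smul]
    calc inner ℝ (T x) (T x) = inner ℝ (∑ i, inner ℝ (b i) x • T (b i)) (T x) := by rw [← hx]
      _ = ∑ i, ν i ^ 2 * (inner ℝ (b i) x) ^ 2 := by
        rw [sum_inner]
        refine Finset.sum_congr rfl fun i _ => ?_
        rw [real_inner_smul_left, hin]
        ring
  refine ⟨ν, b, fun i j hij => T.singularValues_antitone hij, hpos, ?_, hquad⟩
  set V₂ : Mat n := Matrix.of fun i a => b i a with hV₂
  set V₁ : Mat n := Matrix.of fun a i => (ν i)⁻¹ * T (b i) a with hV₁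
  have h2 : V₂ᵀ * V₂ = 1 := by
    rw [mul_eq_one_comm]
    ext i j
    have := (orthonormal_iff_ite.1 b.orthonormal) j i
    simp only [PiLp.inner_apply, RCLike.inner_apply, conj_trivial] at this
    simp only [hV₂, Matrix.mul_apply, Matrix.transpose_apply, Matrix.of_apply, this,
      Matrix.one_apply, eq_comm]
  have h1 : V₁ᵀ * V₁ = 1 := by
    ext i j
    have h3 := hin (b j) i
    rw [(orthonormal_iff_ite.1 b.orthonormal) i j] at h3
    simp only [PiLp.inner_apply, RCLike.inner_apply, conj_trivial] at h3
    have h4 : (V₁ᵀ * V₁) i j = (ν i)⁻¹ * (ν j)⁻¹ * ∑ a, T (b j) a * T (b i) a := by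
      simp only [hV₁, Matrix.mul_apply, Matrix.transpose_apply, Matrix.of_apply, Finset.mul_sum]
      exact Finset.sum_congr rfl fun a _ => by ring
    rw [h4, h3, Matrix.one_apply]
    split_ifs with hij
    · subst hij
      have := (hpos i).ne'
      field_simp
    · simp
  refine ⟨V₁, V₂, h1, h2, ?_⟩
  have h3 : A * V₂ᵀ = V₁ * Matrix.diagonal ν := by
    ext a i
    rw [Matrix.mul_diagonal]
    simp only [hV₁, hV₂, Matrix.mul_apply, Matrix.transpose_apply, Matrix.of_apply, hTA,
      matVec_apply]
    have := (hpos i).ne'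
    field_simp
  rw [← h3, Matrix.mul_assoc, h2, Matrix.mul_one]

/-- Localisation of the singular values of a matrix by its action on coordinate subspaces. -/
theorem sameSingular_of_bounds {n j : ℕ} (hj : j < n) (A : Mat n) (T : Finset (Fin n))
    (hT : T.card = j + 1) {a b a' b' : ℝ} (ha' : 0 < a')
    (hlow : ∀ x : Euc n, (∀ i ∉ T, x i = 0) → a * ‖x‖ ≤ ‖matVec A x‖)
    (hup : ∀ x : Euc n, ‖matVec A x‖ ≤ b * ‖x‖)
    (hup' : ∀ x : Euc n, (∀ i ∈ T, x i = 0) → ‖matVec A x‖ ≤ b' * ‖x‖)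
    (hlow' : ∀ x : Euc n, a' * ‖x‖ ≤ ‖matVec A x‖) :
    ∃ ν : Fin n → ℝ, sameSingular A (Matrix.diagonal ν) ∧
      (∀ i : Fin n, (i : ℕ) < j + 1 → ν i ∈ Icc a b) ∧
      (∀ i : Fin n, j + 1 ≤ (i : ℕ) → ν i ∈ Icc a' b') := by
  obtain ⟨ν, e, hanti, hpos, hsame, hquad⟩ := exists_singular_value_decomposition A (by
    intro x hx h0
    have := hlow' x
    rw [h0, norm_zero] at this
    have := norm_pos_iff.2 hx
    nlinarith)
  have hpars : ∀ x : Euc n, ‖x‖ ^ 2 = ∑ i, (inner ℝ (e i) x) ^ 2 := by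
    intro x
    rw [← e.sum_sq_norm_inner_right x]
    simp
  have hdiag : ∀ i, ‖matVec A (e i)‖ = ν i := by
    intro i
    have h := hquad (e i)
    simp only [(orthonormal_iff_ite.1 e.orthonormal)] at h
    simp only [ite_pow, one_pow, ne_eq, OfNat.ofNat_ne_zero, not_false_eq_true, zero_pow, mul_ite,
      mul_one, mul_zero, Finset.sum_ite_eq', Finset.mem_univ, if_true] at h
    exact (sq_eq_sq₀ (norm_nonneg _) (hpos i).le).1 h
  have hνb : ∀ i, ν i ≤ b := fun i => by
    simpa [hdiag i, e.orthonormal.norm_eq_one] using hup (e i)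
  have hνa' : ∀ i, a' ≤ ν i := fun i => by
    simpa [hdiag i, e.orthonormal.norm_eq_one] using hlow' (e i)
  have hTc : (Tᶜ).card = n - (j + 1) := by rw [Finset.card_compl, hT, Fintype.card_fin]
  have hνa : ∀ i : Fin n, (i : ℕ) < j + 1 → a ≤ ν i := by
    intro i hi
    obtain ⟨x, hx0, hx⟩ := exists_ne_zero_forall_eq_zero (E := Euc n)
      (ι := {l : Fin n // l ∈ Tᶜ} ⊕ {l : Fin n // l ∈ Finset.Iio i})
      (Sum.elim (fun l => (EuclideanSpace.proj l.1 : Euc n →L[ℝ] ℝ).toLinearMap)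
        (fun l => (innerSL ℝ (e l.1)).toLinearMap)) (by
        simp only [Fintype.card_sum, Fintype.card_coe, hTc, Fin.card_Iio, finrank_euclideanSpace,
          Fintype.card_fin]
        omega)
    have hxT : ∀ l ∉ T, x l = 0 := fun l hl => hx (Sum.inl ⟨l, Finset.mem_compl.2 hl⟩)
    have hxe : ∀ l < i, inner ℝ (e l) x = 0 := fun l hl => hx (Sum.inr ⟨l, Finset.mem_Iio.2 hl⟩)
    have h1 : ‖matVec A x‖ ^ 2 ≤ ν i ^ 2 * ‖x‖ ^ 2 := by
      rw [hquad, hpars, Finset.mul_sum]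
      refine Finset.sum_le_sum fun l _ => ?_
      rcases lt_or_ge l i with h | h
      · simp [hxe l h]
      · exact mul_le_mul_of_nonneg_right
          (pow_le_pow_left₀ (hpos l).le (hanti h) 2) (sq_nonneg _)
    rw [← mul_pow] at h1
    have h2 := abs_le_of_sq_le_sq h1 (mul_nonneg (hpos i).le (norm_nonneg _))
    exact le_of_mul_le_mul_right ((hlow x hxT).trans ((le_abs_self _).trans h2))
      (norm_pos_iff.2 hx0)
  have hνb' : ∀ i : Fin n, j + 1 ≤ (i : ℕ) → ν i ≤ b' := by
    intro i hi
    obtain ⟨x, hx0, hx⟩ := exists_ne_zero_forall_eq_zero (E := Euc n)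
      (ι := {l : Fin n // l ∈ T} ⊕ {l : Fin n // l ∈ Finset.Ioi i})
      (Sum.elim (fun l => (EuclideanSpace.proj l.1 : Euc n →L[ℝ] ℝ).toLinearMap)
        (fun l => (innerSL ℝ (e l.1)).toLinearMap)) (by
        simp only [Fintype.card_sum, Fintype.card_coe, hT, Fin.card_Ioi, finrank_euclideanSpace,
          Fintype.card_fin]
        omega)
    have hxT : ∀ l ∈ T, x l = 0 := fun l hl => hx (Sum.inl ⟨l, hl⟩)
    have hxe : ∀ l, i < l → inner ℝ (e l) x = 0 := fun l hl =>
      hx (Sum.inr ⟨l, Finset.mem_Ioi.2 hl⟩)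
    have h1 : ν i ^ 2 * ‖x‖ ^ 2 ≤ ‖matVec A x‖ ^ 2 := by
      rw [hquad, hpars, Finset.mul_sum]
      refine Finset.sum_le_sum fun l _ => ?_
      rcases lt_or_ge i l with h | h
      · simp [hxe l h]
      · exact mul_le_mul_of_nonneg_right
          (pow_le_pow_left₀ (hpos i).le (hanti h) 2) (sq_nonneg _)
    rw [← mul_pow] at h1
    have h2 := abs_le_of_sq_le_sq h1 (norm_nonneg _)
    exact le_of_mul_le_mul_right (((le_abs_self _).trans h2).trans (hup' x hxT))
      (norm_pos_iff.2 hx0)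
  exact ⟨ν, hsame, fun i hi => ⟨hνa i hi, hνb i⟩, fun i hi => ⟨hνa' i, hνb' i hi⟩⟩

/-- The weighted `ℓ¹` ball. -/
def weightedBall {n : ℕ} (a : Fin n → ℝ) (r : ℝ) : Set (Euc n) := {z | ∑ i, a i * |z i| ≤ r}

theorem convex_weightedBall {n : ℕ} {a : Fin n → ℝ} (ha : ∀ i, 0 ≤ a i) (r : ℝ) :
    Convex ℝ (weightedBall a r) := by
  intro x hx y hy u v hu hv huv
  have h1 : ∑ i, a i * |(u • x + v • y) i| ≤ ∑ i, (u * (a i * |x i|) + v * (a i * |y i|)) := by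
    refine Finset.sum_le_sum fun i _ => ?_
    have h2 := abs_add_le (u * x i) (v * y i)
    rw [abs_mul, abs_mul, abs_of_nonneg hu, abs_of_nonneg hv] at h2
    have h3 := mul_le_mul_of_nonneg_left h2 (ha i)
    simp only [PiLp.add_apply, PiLp.smul_apply, smul_eq_mul]
    linarith
  rw [Finset.sum_add_distrib, ← Finset.mul_sum, ← Finset.mul_sum] at h1
  change ∑ i, a i * |x i| ≤ r at hx
  change ∑ i, a i * |y i| ≤ r at hy
  change ∑ i, a i * |(u • x + v • y) i| ≤ r
  calc _ ≤ _ := h1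
    _ ≤ u * r + v * r := by gcongr
    _ = r := by rw [← add_mul, huv, one_mul]

theorem isClosed_weightedBall {n : ℕ} (a : Fin n → ℝ) (r : ℝ) : IsClosed (weightedBall a r) :=
  isClosed_le (by fun_prop) (by fun_prop)

theorem zero_mem_weightedBall {n : ℕ} (a : Fin n → ℝ) {r : ℝ} (hr : 0 ≤ r) :
    (0 : Euc n) ∈ weightedBall a r := by
  simpa [weightedBall] using hr

theorem single_mem_weightedBall {n : ℕ} (a : Fin n → ℝ) {r : ℝ} (i : Fin n) {c : ℝ}
    (h : a i * |c| ≤ r) : (EuclideanSpace.single i c : Euc n) ∈ weightedBall a r := by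
  have : ∑ l, a l * |(EuclideanSpace.single i c : Euc n) l| = a i * |c| := by
    rw [Finset.sum_eq_single i]
    · simp
    · intro l _ hl
      simp [hl]
    · simp
  exact this.trans_le h

/-- The value `a` at `p` and `b` elsewhere. -/
def oneWeight {n : ℕ} (p : Fin n) (a b : ℝ) : Fin n → ℝ := fun i => if i = p then a else b

/-- The `ℓ¹` norm of the coordinates different from `p`. -/
def transverseNorm {n : ℕ} (p : Fin n) (z : Euc n) : ℝ := ∑ i ∈ Finset.univ.erase p, |z i|

theorem transverseNorm_nonneg {n : ℕ} (p : Fin n) (z : Euc n) : 0 ≤ transverseNorm p z :=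
  Finset.sum_nonneg fun _ _ => abs_nonneg _

theorem continuous_transverseNorm {n : ℕ} (p : Fin n) :
    Continuous (transverseNorm p : Euc n → ℝ) := by
  unfold transverseNorm; fun_prop

theorem sum_oneWeight {n : ℕ} (p : Fin n) (a b : ℝ) (f : Fin n → ℝ) :
    ∑ i, oneWeight p a b i * f i = a * f p + b * ∑ i ∈ Finset.univ.erase p, f i := by
  rw [← Finset.add_sum_erase _ _ (Finset.mem_univ p), Finset.mul_sum]
  congr 1
  · simp [oneWeight]
  · refine Finset.sum_congr rfl fun i hi => ?_
    simp [oneWeight, Finset.ne_of_mem_erase hi]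

theorem mem_weightedBall_oneWeight {n : ℕ} (p : Fin n) (a b r : ℝ) (z : Euc n) :
    z ∈ weightedBall (oneWeight p a b) r ↔ a * |z p| + b * transverseNorm p z ≤ r := by
  rw [transverseNorm, ← sum_oneWeight p a b fun i => |z i|]
  rfl

/-- The model diamond, thin in direction `p`. -/
def thinDiamond {n : ℕ} (p : Fin n) (δ : ℝ) : Set (Euc n) := weightedBall (oneWeight p 1 δ) δ

/-- The part of the thin diamond where the laminate has slope `-t`. -/
def laminateCore {n : ℕ} (p : Fin n) (δ s t : ℝ) : Set (Euc n) :=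
  weightedBall (oneWeight p (s + t) (s * δ)) (s * δ)

/-- The scalar laminate profile with slopes `s` and `-t` in direction `p`. -/
def laminateProfile {n : ℕ} (p : Fin n) (δ s t : ℝ) (z : Euc n) : ℝ :=
  max (s * (z p - δ * (1 - transverseNorm p z)))
    (min (s * (z p + δ * (1 - transverseNorm p z))) (-(t * z p)))

/-- The sign encoded by a Boolean. -/
def boolSign (b : Bool) : ℝ := if b then 1 else -1

theorem boolSign_mul_self (b : Bool) : boolSign b * boolSign b = 1 := by
  cases b <;> simp [boolSign]

theorem abs_boolSign (b : Bool) : |boolSign b| = 1 := by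
  cases b <;> simp [boolSign]

theorem abs_eq_boolSign_mul {b : Bool} {x : ℝ} (h : 0 ≤ boolSign b * x) :
    |x| = boolSign b * x := by
  rw [← abs_of_nonneg h, abs_mul, abs_boolSign, one_mul]

theorem boolSign_mul_nonneg_of_iff {b : Bool} {x : ℝ} (h : b = true ↔ 0 ≤ x) :
    0 ≤ boolSign b * x := by
  cases b
  · have : x < 0 := by simpa using h
    simp [boolSign, this.le]
  · simpa [boolSign] using h

/-- The gradients of the laminate profile. -/
def laminateSlope {n : ℕ} (p : Fin n) (δ s t : ℝ) : Option (Fin n → Bool) → Fin n → ℝ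
  | none => Pi.single p (-t)
  | some τ => fun i => if i = p then s else s * δ * (boolSign (τ p) * boolSign (τ i))

/-- The constant terms of the laminate profile. -/
def laminateOffset {n : ℕ} (p : Fin n) (δ s : ℝ) : Option (Fin n → Bool) → ℝ
  | none => 0
  | some τ => -(boolSign (τ p) * (s * δ))

/-- The convex pieces of the thin diamond on which the laminate profile is affine. -/
def laminateCell {n : ℕ} (p : Fin n) (δ s t : ℝ) : Option (Fin n → Bool) → Set (Euc n)
  | none => laminateCore p δ s t
  | some τ => {z | z ∈ thinDiamond p δ ∧ z ∉ laminateCore p δ s t ∧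
      ∀ i, (τ i = true ↔ 0 ≤ z i)}

/-- Closed convex supersets of the laminate cells. -/
def laminateClosedCell {n : ℕ} (p : Fin n) (δ s t : ℝ) : Option (Fin n → Bool) → Set (Euc n)
  | none => laminateCore p δ s t
  | some τ => {z | z ∈ thinDiamond p δ ∧
      s * δ ≤ ∑ i, oneWeight p (s + t) (s * δ) i * (boolSign (τ i) * z i) ∧
      ∀ i, 0 ≤ boolSign (τ i) * z i}

/-- The cell of the laminate containing a given point of the thin diamond. -/
def laminateLabel {n : ℕ} (p : Fin n) (δ s t : ℝ) (z : Euc n) : Option (Fin n → Bool) :=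
  open Classical in
  if z ∈ laminateCore p δ s t then none else some fun i => decide (0 ≤ z i)

section Laminate

variable {n : ℕ} {p : Fin n} {δ s t : ℝ}

theorem laminateCore_subset_thinDiamond (hs : 0 < s) (ht : 0 < t) :
    laminateCore p δ s t ⊆ thinDiamond p δ := by
  intro z hz
  rw [laminateCore, mem_weightedBall_oneWeight] at hz
  rw [thinDiamond, mem_weightedBall_oneWeight]
  have h1 : s * (|z p| + δ * transverseNorm p z) ≤ s * δ := by
    nlinarith [mul_nonneg ht.le (abs_nonneg (z p))]
  have := le_of_mul_le_mul_left h1 hs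
  linarith

theorem mem_laminateCell_iff (hs : 0 < s) (ht : 0 < t)
    (l : Option (Fin n → Bool)) (z : Euc n) :
    z ∈ laminateCell p δ s t l ↔ z ∈ thinDiamond p δ ∧ laminateLabel p δ s t z = l := by
  by_cases h : z ∈ laminateCore p δ s t
  · have h2 := laminateCore_subset_thinDiamond hs ht h
    cases l <;> simp [laminateCell, laminateLabel, h, h2]
  · cases l with
    | none => simp [laminateCell, laminateLabel, h]
    | some τ =>
      simp only [laminateCell, laminateLabel, h, not_false_eq_true, true_and, if_false,
        Set.mem_ofPred_eq, Option.some.injEq, funext_iff]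
      refine and_congr_right fun _ => forall_congr' fun i => ?_
      cases τ i <;> simp

theorem sum_oneWeight_boolSign {τ : Fin n → Bool} {z : Euc n} (a b : ℝ)
    (hz : ∀ i, 0 ≤ boolSign (τ i) * z i) :
    ∑ i, oneWeight p a b i * (boolSign (τ i) * z i) = a * |z p| + b * transverseNorm p z := by
  rw [sum_oneWeight, transverseNorm, abs_eq_boolSign_mul (hz p)]
  simp_rw [fun i => abs_eq_boolSign_mul (hz i)]

theorem laminateCell_subset_closedCell (l : Option (Fin n → Bool)) :
    laminateCell p δ s t l ⊆ laminateClosedCell p δ s t l := by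
  cases l with
  | none => exact subset_rfl
  | some τ =>
    rintro z ⟨h1, h2, h3⟩
    have h4 : ∀ i, 0 ≤ boolSign (τ i) * z i := fun i => boolSign_mul_nonneg_of_iff (h3 i)
    refine ⟨h1, ?_, h4⟩
    rw [laminateCore, mem_weightedBall_oneWeight, not_le] at h2
    rw [sum_oneWeight_boolSign _ _ h4]
    exact h2.le

theorem laminateProfile_eq (hs : 0 < s) (ht : 0 < t)
    {l : Option (Fin n → Bool)} {z : Euc n} (hz : z ∈ laminateClosedCell p δ s t l) :
    laminateProfile p δ s t z = ∑ i, laminateSlope p δ s t l i * z i + laminateOffset p δ s l := by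
  set q := δ * (1 - transverseNorm p z) with hq
  cases l with
  | none =>
    have h1 : (s + t) * |z p| ≤ s * q := by
      change z ∈ weightedBall _ _ at hz
      rw [mem_weightedBall_oneWeight] at hz
      rw [hq]; linarith
    have hq0 : 0 ≤ q := by
      by_contra! h
      nlinarith [abs_nonneg (z p), mul_nonneg (add_pos hs ht).le (abs_nonneg (z p))]
    have h2 : ∑ i, laminateSlope p δ s t none i * z i = -(t * z p) := by
      rw [Finset.sum_eq_single p]
      · simp [laminateSlope]
      · intro i _ hi
        simp [laminateSlope, hi]
      · simp
    rw [h2, laminateProfile, ← hq, laminateOffset, add_zero]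
    rcases le_total 0 (z p) with h | h
    · rw [abs_of_nonneg h] at h1
      rw [min_eq_right (by nlinarith), max_eq_right (by nlinarith)]
    · rw [abs_of_nonpos h] at h1
      rw [min_eq_right (by nlinarith), max_eq_right (by nlinarith)]
  | some τ =>
    obtain ⟨h1, h2, h3⟩ := hz
    rw [thinDiamond, mem_weightedBall_oneWeight] at h1
    rw [sum_oneWeight_boolSign _ _ h3] at h2
    have hq1 : |z p| ≤ q := by rw [hq]; linarith
    have hq2 : s * q ≤ (s + t) * |z p| := by rw [hq]; linarith
    have hq0 : 0 ≤ q := (abs_nonneg _).trans hq1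
    have h4 : ∑ i, laminateSlope p δ s t (some τ) i * z i
        = s * z p + s * δ * boolSign (τ p) * transverseNorm p z := by
      rw [← Finset.add_sum_erase _ _ (Finset.mem_univ p), transverseNorm, Finset.mul_sum]
      congr 1
      · simp [laminateSlope]
      · refine Finset.sum_congr rfl fun i hi => ?_
        rw [abs_eq_boolSign_mul (h3 i)]
        simp only [laminateSlope, Finset.ne_of_mem_erase hi, if_false]
        ring
    have h5 : s * z p + s * δ * boolSign (τ p) * transverseNorm p z + -(boolSign (τ p) * (s * δ))
        = s * (z p - boolSign (τ p) * q) := by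
      rw [hq]; ring
    rw [h4, laminateOffset, h5, laminateProfile, ← hq]
    have h6 := h3 p
    cases hτ : τ p
    · have h : z p ≤ 0 := by simpa [boolSign, hτ] using h6
      rw [abs_of_nonpos h] at hq1 hq2
      simp only [boolSign, Bool.false_eq_true, if_false]
      rw [min_eq_left (by nlinarith), max_eq_right (by nlinarith)]
      ring
    · have h : 0 ≤ z p := by simpa [boolSign, hτ] using h6
      rw [abs_of_nonneg h] at hq1 hq2
      simp only [boolSign, if_true]
      rw [min_eq_right (by nlinarith), max_eq_left (by nlinarith)]
      ring

theorem laminateProfile_eq_zero (hs : 0 < s) (ht : 0 < t) {z : Euc n}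
    (hz : |z p| + δ * transverseNorm p z = δ) : laminateProfile p δ s t z = 0 := by
  have hq : δ * (1 - transverseNorm p z) = |z p| := by linarith
  rw [laminateProfile, hq]
  rcases le_total 0 (z p) with h | h
  · rw [abs_of_nonneg h, min_eq_right (by nlinarith), max_eq_left (by nlinarith)]
    ring
  · rw [abs_of_nonpos h, min_eq_left (by nlinarith), max_eq_right (by nlinarith)]
    ring

theorem continuous_laminateProfile : Continuous (laminateProfile p δ s t : Euc n → ℝ) := by
  have := continuous_transverseNorm p
  unfold laminateProfile
  fun_prop

theorem oneWeight_nonneg {a b : ℝ} (ha : 0 ≤ a) (hb : 0 ≤ b) (i : Fin n) :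
    0 ≤ oneWeight p a b i := by
  unfold oneWeight; split_ifs <;> assumption

theorem convex_thinDiamond (hδ : 0 < δ) : Convex ℝ (thinDiamond p δ) :=
  convex_weightedBall (oneWeight_nonneg zero_le_one hδ.le) _

theorem convex_laminateCore (hδ : 0 < δ) (hs : 0 < s) (ht : 0 < t) :
    Convex ℝ (laminateCore p δ s t) :=
  convex_weightedBall (oneWeight_nonneg (add_pos hs ht).le (mul_pos hs hδ).le) _

theorem isLinearMap_sum_mul (c : Fin n → ℝ) :
    IsLinearMap ℝ fun z : Euc n => ∑ i, c i * z i := by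
  constructor
  · intro x y
    simp [mul_add, Finset.sum_add_distrib]
  · intro a x
    simp only [PiLp.smul_apply, smul_eq_mul, Finset.mul_sum]
    exact Finset.sum_congr rfl fun i _ => by ring

theorem isLinearMap_coord (i : Fin n) : IsLinearMap ℝ fun z : Euc n => z i :=
  ⟨fun _ _ => rfl, fun _ _ => rfl⟩

theorem convex_laminateCell (hδ : 0 < δ) (hs : 0 < s) (ht : 0 < t) (l : Option (Fin n → Bool)) :
    Convex ℝ (laminateCell p δ s t l) := by
  cases l with
  | none => exact convex_laminateCore hδ hs ht
  | some τ =>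
    have h : laminateCell p δ s t (some τ) = thinDiamond p δ ∩
        ({z : Euc n | s * δ < ∑ i, oneWeight p (s + t) (s * δ) i * boolSign (τ i) * z i} ∩
          ⋂ i, {z : Euc n | τ i = true ↔ 0 ≤ z i}) := by
      ext z
      simp only [laminateCell, Set.mem_ofPred_eq, Set.mem_inter_iff, Set.mem_iInter]
      refine and_congr_right fun _ => and_congr_left fun h3 => ?_
      rw [laminateCore, mem_weightedBall_oneWeight, not_le, ← sum_oneWeight_boolSign _ _
        fun i => boolSign_mul_nonneg_of_iff (h3 i)]
      simp only [mul_assoc]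
    rw [h]
    refine (convex_thinDiamond hδ).inter ((convex_halfSpace_gt (isLinearMap_sum_mul _) _).inter
      (convex_iInter fun i => ?_))
    cases hτ : τ i
    · have : {z : Euc n | false = true ↔ 0 ≤ z i} = {z | z i < 0} := by ext; simp
      rw [this]
      exact convex_halfSpace_lt (isLinearMap_coord i) 0
    · have : {z : Euc n | true = true ↔ 0 ≤ z i} = {z | 0 ≤ z i} := by ext; simp
      rw [this]
      exact convex_halfSpace_ge (isLinearMap_coord i) 0

theorem convex_laminateClosedCell (hδ : 0 < δ) (hs : 0 < s) (ht : 0 < t)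
    (l : Option (Fin n → Bool)) : Convex ℝ (laminateClosedCell p δ s t l) := by
  cases l with
  | none => exact convex_laminateCore hδ hs ht
  | some τ =>
    have h : laminateClosedCell p δ s t (some τ) = thinDiamond p δ ∩
        ({z : Euc n | s * δ ≤ ∑ i, oneWeight p (s + t) (s * δ) i * boolSign (τ i) * z i} ∩
          ⋂ i, {z : Euc n | 0 ≤ boolSign (τ i) * z i}) := by
      ext z
      simp only [laminateClosedCell, mul_assoc, Set.mem_ofPred_eq, Set.mem_inter_iff,
        Set.mem_iInter]
    rw [h]
    refine (convex_thinDiamond hδ).inter ((convex_halfSpace_ge (isLinearMap_sum_mul _) _).inter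
      (convex_iInter fun i => convex_halfSpace_ge
        ⟨fun x y => by simp [mul_add], fun c x => by simp; ring⟩ _))

end Laminate

theorem smul_single_one {n : ℕ} (i : Fin n) (c : ℝ) :
    c • (EuclideanSpace.single i (1 : ℝ) : Euc n) = EuclideanSpace.single i c := by
  ext l
  simp [PiLp.single_apply]

theorem neg_single {n : ℕ} (i : Fin n) (c : ℝ) :
    -(EuclideanSpace.single i c : Euc n) = EuclideanSpace.single i (-c) := by
  rw [← smul_single_one i c, ← smul_single_one i (-c), neg_smul]

theorem single_zero {n : ℕ} (i : Fin n) : (EuclideanSpace.single i (0 : ℝ) : Euc n) = 0 := by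
  rw [← smul_single_one, zero_smul]

section Simplices

variable {n : ℕ} {p : Fin n} {δ s t : ℝ}

/-- Vertices of the simplices triangulating the thin diamond. -/
def simplexVertex (p : Fin n) (δ c θ : ℝ) (τ : Fin n → Bool) : Option (Fin n) → Euc n
  | none => EuclideanSpace.single p (boolSign (τ p) * c)
  | some i => EuclideanSpace.single i (boolSign (τ i) * oneWeight p (θ * δ) 1 i)

theorem mem_convexHull_simplexVertex {c θ a b : ℝ} {z : Euc n} {τ : Fin n → Bool}
    (hτ : ∀ i, 0 ≤ boolSign (τ i) * z i) (ha : 0 ≤ a) (hb : 0 ≤ b)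
    (hab : a + b + transverseNorm p z = 1) (hz : |z p| = a * c + b * (θ * δ)) :
    z ∈ convexHull ℝ (Set.range (simplexVertex p δ c θ τ)) := by
  set u : Option (Fin n) → ℝ := fun o => o.elim a fun i => if i = p then b else |z i| with hu
  have hz' : ∀ i, z i = boolSign (τ i) * |z i| := fun i => by
    rw [abs_eq_boolSign_mul (hτ i), ← mul_assoc, boolSign_mul_self, one_mul]
  have hsum : z = ∑ o, u o • simplexVertex p δ c θ τ o := by
    ext l
    rw [Fintype.sum_option]
    simp only [hu, simplexVertex, PiLp.add_apply, PiLp.smul_apply, WithLp.ofLp_sum,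
      Finset.sum_apply, smul_eq_mul, Option.elim, PiLp.single_apply,
      WithLp.ofLp_smul, Pi.smul_apply, mul_ite, mul_zero, Finset.sum_ite_eq,
      Finset.mem_univ, if_true]
    by_cases hl : l = p
    · subst hl
      simp only [if_true, oneWeight]
      rw [hz' l, hz]; ring
    · simp only [hl, if_false, oneWeight]
      rw [hz' l, abs_mul, abs_boolSign, abs_abs]; ring
  have h1 : ∑ o, u o = 1 := by
    rw [Fintype.sum_option, ← hab, add_assoc]
    simp only [hu, Option.elim]
    congr 1
    rw [← Finset.add_sum_erase _ _ (Finset.mem_univ p), transverseNorm, if_pos rfl]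
    congr 1
    exact Finset.sum_congr rfl fun i hi => by rw [if_neg (Finset.ne_of_mem_erase hi)]
  have h0 : ∀ o ∈ Finset.univ, 0 ≤ u o := by
    rintro (_ | i) _
    · exact ha
    · simp only [hu, Option.elim]
      split_ifs
      exacts [hb, abs_nonneg _]
  rw [hsum]
  exact (convex_convexHull ℝ _).sum_mem h0 h1 fun o _ => subset_convexHull ℝ _ ⟨o, rfl⟩

theorem mem_convexHull_inner {θ : ℝ} (hδ : 0 < δ) (hθ : 0 < θ) {z : Euc n} {τ : Fin n → Bool}
    (hτ : ∀ i, 0 ≤ boolSign (τ i) * z i) (hz : |z p| ≤ θ * δ * (1 - transverseNorm p z)) :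
    z ∈ convexHull ℝ (Set.range (simplexVertex p δ 0 θ τ)) := by
  have h := mul_pos hθ hδ
  refine mem_convexHull_simplexVertex (a := 1 - transverseNorm p z - |z p| / (θ * δ))
    (b := |z p| / (θ * δ)) hτ ?_ (by positivity) (by ring) (by field_simp; ring)
  rw [sub_nonneg, div_le_iff₀ h]
  linarith

theorem mem_convexHull_outer {θ : ℝ} (hδ : 0 < δ) (hθ : θ < 1) {z : Euc n}
    {τ : Fin n → Bool} (hτ : ∀ i, 0 ≤ boolSign (τ i) * z i)
    (hz1 : |z p| ≤ δ * (1 - transverseNorm p z))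
    (hz2 : θ * δ * (1 - transverseNorm p z) ≤ |z p|) :
    z ∈ convexHull ℝ (Set.range (simplexVertex p δ δ θ τ)) := by
  have h : 0 < δ * (1 - θ) := mul_pos hδ (sub_pos.2 hθ)
  have h' := sub_pos.2 hθ
  refine mem_convexHull_simplexVertex
    (a := (|z p| - θ * δ * (1 - transverseNorm p z)) / (δ * (1 - θ)))
    (b := 1 - transverseNorm p z -
      (|z p| - θ * δ * (1 - transverseNorm p z)) / (δ * (1 - θ))) hτ
    (div_nonneg (by linarith) h.le) ?_ (by ring) (by field_simp; ring)
  rw [sub_nonneg, div_le_iff₀ h]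
  nlinarith

theorem exists_boolSign (z : Euc n) : ∃ τ : Fin n → Bool, ∀ i, 0 ≤ boolSign (τ i) * z i :=
  ⟨fun i => decide (0 ≤ z i), fun i => boolSign_mul_nonneg_of_iff (by simp)⟩

theorem baseDiamond_eq_thinDiamond (hp : (p : ℕ) = 1) (hδ : 0 < δ) :
    baseDiamond n δ = thinDiamond p δ := by
  have hw : ∀ i : Fin n, (if (i : ℕ) = 1 then δ else 1) = oneWeight p δ 1 i := fun i => by
    simp [oneWeight, Fin.ext_iff, hp]
  have hv : ∀ i, EuclideanSpace.single i (oneWeight p δ 1 i) ∈ baseDiamond n δ ∧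
      EuclideanSpace.single i (-oneWeight p δ 1 i) ∈ baseDiamond n δ := by
    intro i
    constructor
    · refine subset_convexHull ℝ _ ⟨i, Or.inl ?_⟩
      rw [hw, smul_single_one]
    · refine subset_convexHull ℝ _ ⟨i, Or.inr ?_⟩
      rw [hw, smul_single_one, neg_single]
  have hconv : Convex ℝ (baseDiamond n δ) := convex_convexHull ℝ _
  have h0 : (0 : Euc n) ∈ baseDiamond n δ := by
    have := hconv (hv p).1 (hv p).2 (by norm_num : (0 : ℝ) ≤ 1 / 2)
      (by norm_num : (0 : ℝ) ≤ 1 / 2) (by norm_num)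
    rwa [← neg_single, smul_neg, add_neg_cancel] at this
  refine Set.Subset.antisymm (convexHull_min ?_ (convex_thinDiamond hδ)) fun z hz => ?_
  · have : ∀ i, oneWeight p 1 δ i * |oneWeight p δ 1 i| ≤ δ := by
      intro i
      by_cases h : i = p
      · simp [oneWeight, h, abs_of_pos hδ]
      · simp [oneWeight, h]
    rintro v ⟨i, rfl | rfl⟩
    · rw [hw, smul_single_one]
      exact single_mem_weightedBall _ _ (this i)
    · rw [hw, smul_single_one, neg_single]
      exact single_mem_weightedBall _ _ (by rw [abs_neg]; exact this i)
  · obtain ⟨τ, hτ⟩ := exists_boolSign z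
    rw [thinDiamond, mem_weightedBall_oneWeight] at hz
    refine convexHull_min ?_ hconv (mem_convexHull_inner (p := p) hδ one_pos hτ (by linarith))
    rintro _ ⟨o | i, rfl⟩
    · simpa [simplexVertex, single_zero] using h0
    · simp only [simplexVertex, one_mul]
      cases τ i
      · simpa [boolSign] using (hv i).2
      · simpa [boolSign] using (hv i).1

/-- The polytopes of the triangulation of the thin diamond. -/
def simplexPolytope (p : Fin n) (δ s t : ℝ) (τ : Fin n → Bool) (b : Bool) : Set (Euc n) :=
  convexHull ℝ (Set.range (simplexVertex p δ (if b then δ else 0) (s / (s + t)) τ))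

theorem thinDiamond_subset_iUnion_simplexPolytope (hδ : 0 < δ) (hs : 0 < s) (ht : 0 < t)
    {z : Euc n} (hz : z ∈ thinDiamond p δ) : ∃ τ b, z ∈ simplexPolytope p δ s t τ b := by
  obtain ⟨τ, hτ⟩ := exists_boolSign z
  rw [thinDiamond, mem_weightedBall_oneWeight] at hz
  have hst := add_pos hs ht
  rcases le_total (|z p|) (s / (s + t) * δ * (1 - transverseNorm p z)) with h | h
  · exact ⟨τ, false, mem_convexHull_inner hδ (div_pos hs hst) hτ h⟩
  · exact ⟨τ, true, mem_convexHull_outer hδ ((div_lt_one hst).2 (by linarith)) hτ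
      (by linarith) h⟩

theorem simplexPolytope_subset_closedCell (hδ : 0 < δ) (hs : 0 < s) (ht : 0 < t)
    (τ : Fin n → Bool) (b : Bool) : ∃ l, simplexPolytope p δ s t τ b ⊆
      laminateClosedCell p δ s t l := by
  have hst := add_pos hs ht
  have hsδ := mul_pos hs hδ
  have hw : ∀ i, 0 ≤ oneWeight p (s / (s + t) * δ) 1 i :=
    oneWeight_nonneg (by positivity) zero_le_one
  cases b with
  | false =>
    refine ⟨none, convexHull_min ?_ (convex_laminateClosedCell hδ hs ht _)⟩
    rintro _ ⟨o | i, rfl⟩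
    · have h0 : simplexVertex p δ (if false then δ else 0) (s / (s + t)) τ none = 0 := by
        simp [simplexVertex, single_zero]
      rw [h0]
      exact zero_mem_weightedBall _ hsδ.le
    · refine single_mem_weightedBall _ _ ?_
      rw [abs_mul, abs_boolSign, one_mul, abs_of_nonneg (hw i)]
      by_cases h : i = p
      · simp only [oneWeight, h, if_true]
        refine le_of_eq ?_
        field_simp
      · simp [oneWeight, h]
  | true =>
    refine ⟨some τ, convexHull_min ?_ (convex_laminateClosedCell hδ hs ht _)⟩
    have key : ∀ (i : Fin n) (c : ℝ), 0 ≤ c → oneWeight p 1 δ i * c ≤ δ →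
        s * δ ≤ oneWeight p (s + t) (s * δ) i * c →
        EuclideanSpace.single i (boolSign (τ i) * c) ∈ laminateClosedCell p δ s t (some τ) := by
      intro i c hc h1 h2
      have h3 : ∀ l, boolSign (τ l) * (EuclideanSpace.single i (boolSign (τ i) * c) : Euc n) l
          = if l = i then c else 0 := by
        intro l
        rw [PiLp.single_apply]
        split_ifs with h
        · rw [h, ← mul_assoc, boolSign_mul_self, one_mul]
        · simp
      refine ⟨single_mem_weightedBall _ _ ?_, ?_, fun l => ?_⟩
      · rwa [abs_mul, abs_boolSign, one_mul, abs_of_nonneg hc]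
      · simp only [h3, mul_ite, mul_zero, Finset.sum_ite_eq', Finset.mem_univ, if_true]
        exact h2
      · rw [h3]; split_ifs <;> simp [hc]
    rintro _ ⟨o | i, rfl⟩
    · refine key p δ hδ.le (by simp [oneWeight]) ?_
      simp only [oneWeight, if_true]
      nlinarith
    · refine key i _ (hw i) ?_ ?_
      · by_cases h : i = p
        · simp only [oneWeight, h, if_true, one_mul]
          exact mul_le_of_le_one_left hδ.le ((div_le_one hst).2 (by linarith))
        · simp [oneWeight, h]
      · by_cases h : i = p
        · simp only [oneWeight, h, if_true]
          refine le_of_eq ?_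
          field_simp
        · simp [oneWeight, h]

end Simplices

theorem norm_le_norm_of_abs_le {n : ℕ} {x y : Euc n} (h : ∀ i, |x i| ≤ |y i|) : ‖x‖ ≤ ‖y‖ := by
  rw [EuclideanSpace.norm_eq, EuclideanSpace.norm_eq]
  refine Real.sqrt_le_sqrt (Finset.sum_le_sum fun i _ => ?_)
  exact pow_le_pow_left₀ (norm_nonneg _) (h i) 2

theorem matVec_diagonal_apply {n : ℕ} (η : Fin n → ℝ) (x : Euc n) (i : Fin n) :
    matVec (Matrix.diagonal η) x i = η i * x i := by
  simp [matVec_apply, Matrix.diagonal_apply]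

theorem norm_matVec_diagonal_le {n : ℕ} {η : Fin n → ℝ} {c : ℝ} (hc : 0 ≤ c) {x : Euc n}
    (h : ∀ i, x i ≠ 0 → |η i| ≤ c) : ‖matVec (Matrix.diagonal η) x‖ ≤ c * ‖x‖ := by
  rw [← abs_of_nonneg hc, ← Real.norm_eq_abs, ← norm_smul]
  refine norm_le_norm_of_abs_le fun i => ?_
  rw [matVec_diagonal_apply, PiLp.smul_apply, smul_eq_mul, abs_mul, abs_mul, abs_of_nonneg hc]
  by_cases hi : x i = 0
  · simp [hi]
  · exact mul_le_mul_of_nonneg_right (h i hi) (abs_nonneg _)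

theorem le_norm_matVec_diagonal {n : ℕ} {η : Fin n → ℝ} {c : ℝ} (hc : 0 ≤ c) {x : Euc n}
    (h : ∀ i, x i ≠ 0 → c ≤ |η i|) : c * ‖x‖ ≤ ‖matVec (Matrix.diagonal η) x‖ := by
  rw [← abs_of_nonneg hc, ← Real.norm_eq_abs, ← norm_smul]
  refine norm_le_norm_of_abs_le fun i => ?_
  rw [matVec_diagonal_apply, PiLp.smul_apply, smul_eq_mul, abs_mul, abs_mul, abs_of_nonneg hc]
  by_cases hi : x i = 0
  · simp [hi]
  · exact mul_le_mul_of_nonneg_right (h i hi) (abs_nonneg _)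

theorem matVec_vecMulVec_single {n : ℕ} (p : Fin n) (c : Fin n → ℝ) (x : Euc n) :
    matVec (Matrix.vecMulVec (Pi.single p 1) c) x
      = (∑ i, c i * x i) • (EuclideanSpace.single p (1 : ℝ) : Euc n) := by
  ext l
  simp only [matVec_apply, Matrix.vecMulVec_apply, PiLp.smul_apply, smul_eq_mul,
    PiLp.single_apply, Pi.single_apply, mul_assoc, ← Finset.mul_sum]
  ring

theorem abs_coord_le_norm {n : ℕ} (x : Euc n) (i : Fin n) : |x i| ≤ ‖x‖ :=
  PiLp.norm_apply_le x i

theorem norm_matVec_vecMulVec_single_le {n : ℕ} (p : Fin n) {c : Fin n → ℝ} {ε : ℝ}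
    (hc : ∀ i, |c i| ≤ ε) (x : Euc n) :
    ‖matVec (Matrix.vecMulVec (Pi.single p 1) c) x‖ ≤ n * ε * ‖x‖ := by
  rw [matVec_vecMulVec_single, norm_smul, PiLp.norm_single, norm_one, mul_one,
    Real.norm_eq_abs]
  calc |∑ i, c i * x i| ≤ ∑ i, |c i * x i| := Finset.abs_sum_le_sum_abs _ _
    _ ≤ ∑ _i : Fin n, ε * ‖x‖ := Finset.sum_le_sum fun i _ => by
        rw [abs_mul]
        exact mul_le_mul (hc i) (abs_coord_le_norm x i) (abs_nonneg _)
          ((abs_nonneg _).trans (hc i))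
    _ = n * ε * ‖x‖ := by simp [mul_assoc]

theorem dk_pos (k : ℕ) : 0 < dk k := by unfold dk; positivity

theorem dk_le {k : ℕ} (hk : 1 ≤ k) : dk k ≤ 1 / 8 := by
  calc dk k ≤ (1 / 2 : ℝ) ^ 3 :=
        pow_le_pow_of_le_one (by norm_num) (by norm_num) (by omega)
    _ = 1 / 8 := by norm_num

theorem ck_eq (k : ℕ) : ck k = 1 - 3 * dk k := rfl

theorem dk_pred {k : ℕ} (hk : 1 ≤ k) : dk (k - 1) = 2 * dk k := by
  obtain ⟨m, rfl⟩ := Nat.exists_eq_add_of_le hk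
  simp only [dk, Nat.add_sub_cancel_left]
  ring

/-- Small perturbations of a diagonal matrix with one entry moved to `±c_k` lie in the
next in-approximation set. -/
theorem diagonal_add_vecMulVec_mem_Uset {n k j : ℕ} (hk : 1 ≤ k) (hj : j < n) {p : Fin n}
    {T : Finset (Fin n)} (hT : T.card = j + 1) {η c : Fin n → ℝ} (hηp : |η p| = ck k)
    (hηT : ∀ i ∈ T, i ≠ p → η i ∈ Iset k ((1/4 : ℝ) * j / n))
    (hηT' : ∀ i ∉ T, η i ∈ Iset (k - 1) ((1/4 : ℝ) * (1 + (j : ℝ) / n)))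
    (hc : ∀ i, |c i| ≤ dk k / (4 * n ^ 2)) :
    Matrix.diagonal η + Matrix.vecMulVec (Pi.single p 1) c ∈ Uset n k (j + 1) := by
  have hn : (0 : ℝ) < n := by exact_mod_cast (Nat.zero_le j).trans_lt hj
  have hjn : (j : ℝ) + 1 ≤ n := by exact_mod_cast hj
  have hd := dk_pos k
  have hd8 := dk_le hk
  set d := dk k with hd_def
  set ρ : ℝ := (j : ℝ) / n with hρ
  set e : ℝ := 1 / n with he
  have hρ0 : 0 ≤ ρ := by positivity
  have he0 : 0 < e := by positivity
  have hρe : ρ + e ≤ 1 := by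
    rw [hρ, he, ← add_div, div_le_one hn]; exact hjn
  have hρd : 0 ≤ ρ * d := mul_nonneg hρ0 hd.le
  have hed : 0 < e * d := mul_pos he0 hd
  have hρed : ρ * d + e * d ≤ d := by nlinarith
  have hE : ∀ x : Euc n, ‖matVec (Matrix.vecMulVec (Pi.single p 1) c) x‖ ≤ e * d / 4 * ‖x‖ := by
    intro x
    refine (norm_matVec_vecMulVec_single_le p hc x).trans_eq ?_
    rw [he]; field_simp
  have h1 : ∀ i ∈ T, |η i| ≤ 1 - 3 * d + ρ * d / 4 ∧ 1 - 3 * d - ρ * d / 4 ≤ |η i| := by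
    intro i hi
    by_cases hip : i = p
    · rw [hip, hηp, ck_eq]
      constructor <;> linarith
    · have := hηT i hi hip
      rw [Iset, Set.mem_Icc, ck_eq, ← hd_def, mul_div_assoc, ← hρ] at this
      rw [abs_of_nonneg (by linarith)]
      constructor <;> linarith
  have h2 : ∀ i ∉ T, |η i| ≤ 1 - 6 * d + (1 + ρ) * d / 2 ∧ 1 - 6 * d - (1 + ρ) * d / 2 ≤ |η i| := by
    intro i hi
    have := hηT' i hi
    rw [Iset, Set.mem_Icc, ck_eq, dk_pred hk, ← hd_def] at this
    rw [abs_of_nonneg (by linarith)]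
    constructor <;> linarith
  have hup : ∀ x : Euc n, ∀ r : ℝ, 0 ≤ r → (∀ i, x i ≠ 0 → |η i| ≤ r) →
      ‖matVec (Matrix.diagonal η + Matrix.vecMulVec (Pi.single p 1) c) x‖
        ≤ (r + e * d / 4) * ‖x‖ := by
    intro x r hr h
    rw [matVec_add, add_mul]
    linarith [norm_add_le (matVec (Matrix.diagonal η) x)
      (matVec (Matrix.vecMulVec (Pi.single p 1) c) x), norm_matVec_diagonal_le hr h, hE x]
  have hlow : ∀ x : Euc n, ∀ r : ℝ, 0 ≤ r → (∀ i, x i ≠ 0 → r ≤ |η i|) →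
      (r - e * d / 4) * ‖x‖ ≤
      ‖matVec (Matrix.diagonal η + Matrix.vecMulVec (Pi.single p 1) c) x‖ := by
    intro x r hr h
    rw [matVec_add, sub_mul]
    have h3 := le_norm_matVec_diagonal hr h
    have h4 := norm_sub_le (matVec (Matrix.diagonal η) x +
      matVec (Matrix.vecMulVec (Pi.single p 1) c) x)
      (matVec (Matrix.vecMulVec (Pi.single p 1) c) x)
    rw [add_sub_cancel_right] at h4
    linarith [hE x]
  obtain ⟨ν, h3, h4, h5⟩ := sameSingular_of_bounds hj _ T hT
    (a := 1 - 3 * d - ρ * d / 4 - e * d / 4) (b := 1 - 3 * d + ρ * d / 4 + e * d / 4)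
    (a' := 1 - 6 * d - (1 + ρ) * d / 2 - e * d / 4) (b' := 1 - 6 * d + (1 + ρ) * d / 2 + e * d / 4)
    (by linarith)
    (fun x hx => hlow x _ (by linarith) fun i hi => (h1 i (by_contra fun h => hi (hx i h))).2)
    (fun x => hup x _ (by linarith) fun i _ => by
      by_cases hi : i ∈ T
      · exact (h1 i hi).1
      · linarith [(h2 i hi).1])
    (fun x hx => hup x _ (by linarith) fun i hi => (h2 i fun h => hi (hx i h)).1)
    (fun x => hlow x _ (by linarith) fun i _ => by
      by_cases hi : i ∈ T
      · linarith [(h1 i hi).2]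
      · exact (h2 i hi).2)
  have hκ : (1/4 : ℝ) * ((j + 1 : ℕ) : ℝ) / n = (ρ + e) / 4 := by
    rw [hρ, he]; push_cast; field_simp
  have hκ' : (1/4 : ℝ) * (1 + ((j + 1 : ℕ) : ℝ) / n) = (1 + ρ + e) / 4 := by
    rw [hρ, he]; push_cast; field_simp; ring
  refine ⟨ν, h3, fun i hi => ?_, fun i hi => ?_⟩
  · obtain ⟨h6, h7⟩ := h4 i hi
    rw [hκ, Iset, ck_eq, ← hd_def]
    constructor <;> linarith
  · obtain ⟨h6, h7⟩ := h5 i hi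
    rw [hκ', Iset, ck_eq, dk_pred hk, ← hd_def]
    constructor <;> linarith

theorem mul_mul_transpose_mem_Uset {n k j : ℕ} {W Q A : Mat n} (hW : Wᵀ * W = 1)
    (hQ : Qᵀ * Q = 1) (hA : A ∈ Uset n k j) : W * A * Qᵀ ∈ Uset n k j := by
  obtain ⟨μ, ⟨V₁, V₂, h1, h2, rfl⟩, h3⟩ := hA
  refine ⟨μ, ⟨W * V₁, V₂ * Qᵀ, ?_, ?_, by simp only [Matrix.mul_assoc]⟩, h3⟩
  · rw [Matrix.transpose_mul, Matrix.mul_assoc, ← Matrix.mul_assoc Wᵀ, hW, Matrix.one_mul, h1]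
  · rw [Matrix.transpose_mul, Matrix.mul_assoc, ← Matrix.mul_assoc V₂ᵀ, h2, Matrix.one_mul,
      Matrix.transpose_transpose, mul_eq_one_comm.1 hQ]

/-- A matrix with prescribed singular values in any prescribed order, with a rotation as right
factor. -/
theorem sameSingular.exists_rotation {n : ℕ} {M : Mat n} {μ : Fin n → ℝ}
    (h : sameSingular M (Matrix.diagonal μ)) (e : Equiv.Perm (Fin n)) (p : Fin n) :
    ∃ W Q : Mat n, Wᵀ * W = 1 ∧ Qᵀ * Q = 1 ∧ Q.det = 1 ∧
      M = W * Matrix.diagonal (μ ∘ e) * Qᵀ := by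
  obtain ⟨V₁, V₂, h1, h2, rfl⟩ := h
  set Q : Mat n := V₂ᵀ.submatrix id e with hQ_def
  have hQ : Qᵀ * Q = 1 := by
    rw [hQ_def, Matrix.transpose_submatrix, Matrix.transpose_transpose,
      ← Matrix.submatrix_mul _ _ _ _ _ Function.bijective_id, mul_eq_one_comm.1 h2,
      Matrix.submatrix_one_equiv]
  have hdet : Q.det * Q.det = 1 := by
    have := congrArg Matrix.det hQ
    rwa [Matrix.det_mul, Matrix.det_transpose, Matrix.det_one] at this
  set σ : Fin n → ℝ := oneWeight p Q.det 1 with hσ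
  have hσσ : ∀ i, σ i * σ i = 1 := by
    intro i
    simp only [hσ, oneWeight]
    split_ifs
    exacts [hdet, one_mul 1]
  have hS : Matrix.diagonal σ * Matrix.diagonal σ = 1 := by
    rw [Matrix.diagonal_mul_diagonal, ← Matrix.diagonal_one]
    simp only [hσσ]
  refine ⟨V₁.submatrix id e * Matrix.diagonal σ, Q * Matrix.diagonal σ, ?_, ?_, ?_, ?_⟩
  · rw [Matrix.transpose_mul, Matrix.diagonal_transpose, Matrix.mul_assoc,
      ← Matrix.mul_assoc _ _ (Matrix.diagonal σ), Matrix.transpose_submatrix,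
      ← Matrix.submatrix_mul _ _ _ _ _ Function.bijective_id, h1, Matrix.submatrix_one_equiv,
      Matrix.one_mul, hS]
  · rw [Matrix.transpose_mul, Matrix.diagonal_transpose, Matrix.mul_assoc,
      ← Matrix.mul_assoc _ _ (Matrix.diagonal σ), hQ, Matrix.one_mul, hS]
  · rw [Matrix.det_mul, Matrix.det_diagonal, hσ]
    simp only [oneWeight, Finset.prod_ite_eq', Finset.mem_univ, if_true]
    exact hdet
  · rw [Matrix.transpose_mul, Matrix.diagonal_transpose, hQ_def, Matrix.transpose_submatrix,
      Matrix.transpose_transpose]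
    have h3 : Matrix.diagonal σ * Matrix.diagonal (μ ∘ e) * Matrix.diagonal σ
        = (Matrix.diagonal μ).submatrix e e := by
      rw [Matrix.diagonal_mul_diagonal, Matrix.diagonal_mul_diagonal,
        Matrix.submatrix_diagonal_equiv]
      congr 1
      ext i
      rw [mul_right_comm, hσσ, one_mul]
    calc V₁ * Matrix.diagonal μ * V₂
        = V₁.submatrix id e * (Matrix.diagonal μ).submatrix e e * V₂.submatrix e id := by
          rw [Matrix.submatrix_mul_equiv, Matrix.submatrix_mul_equiv, Matrix.submatrix_id_id]
      _ = _ := by rw [← h3]; simp only [Matrix.mul_assoc]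

section Replacement

variable {n : ℕ} {W Q M : Mat n} {p : Fin n} {δ s t : ℝ}

/-- The gradients of the replacement of the linear map `M`. -/
def laminateGradient (W Q M : Mat n) (p : Fin n) (δ s t : ℝ) (l : Option (Fin n → Bool)) :
    Mat n :=
  M + W * Matrix.vecMulVec (Pi.single p 1) (laminateSlope p δ s t l) * Qᵀ

/-- The replacement of the linear map `M` on a rotated thin diamond. -/
def laminateMap (W Q M : Mat n) (p : Fin n) (δ s t : ℝ) (x : Euc n) : Euc n :=
  matVec M x + laminateProfile p δ s t (matVec Qᵀ x) • matVec W (EuclideanSpace.single p 1)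

theorem matVec_smul (A : Mat n) (c : ℝ) (x : Euc n) : matVec A (c • x) = c • matVec A x :=
  map_smul (matCLM A) c x

theorem matVec_laminateGradient (l : Option (Fin n → Bool)) (x : Euc n) :
    matVec (laminateGradient W Q M p δ s t l) x = matVec M x +
      (∑ i, laminateSlope p δ s t l i * matVec Qᵀ x i) • matVec W (EuclideanSpace.single p 1) := by
  rw [laminateGradient, matVec_add, matVec_mul, matVec_mul, matVec_vecMulVec_single, matVec_smul]

theorem laminateMap_eq (hs : 0 < s) (ht : 0 < t) {l : Option (Fin n → Bool)} {x : Euc n}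
    (hx : matVec Qᵀ x ∈ laminateClosedCell p δ s t l) :
    laminateMap W Q M p δ s t x = matVec (laminateGradient W Q M p δ s t l) x +
      laminateOffset p δ s l • matVec W (EuclideanSpace.single p 1) := by
  rw [laminateMap, laminateProfile_eq hs ht hx, matVec_laminateGradient, add_smul, add_assoc]

theorem continuous_matVec (A : Mat n) : Continuous (matVec A) := (matCLM A).continuous

theorem convex_preimage_matVec (A : Mat n) {S : Set (Euc n)} (hS : Convex ℝ S) :
    Convex ℝ (matVec A ⁻¹' S) :=
  hS.linear_preimage (matCLM A : Euc n →ₗ[ℝ] Euc n)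

theorem ae_hasFDerivAt_laminateMap (hδ : 0 < δ) (hs : 0 < s) (ht : 0 < t) :
    ∀ᵐ x, x ∈ matVec Qᵀ ⁻¹' thinDiamond p δ → HasFDerivAt (laminateMap W Q M p δ s t)
      (matCLM (laminateGradient W Q M p δ s t (laminateLabel p δ s t (matVec Qᵀ x)))) x := by
  have h1 : ∀ᵐ x : Euc n, ∀ l, x ∉ frontier (matVec Qᵀ ⁻¹' laminateCell p δ s t l) := by
    rw [ae_all_iff]
    intro l
    exact measure_eq_zero_iff_ae_notMem.1
      (Convex.addHaar_frontier volume (convex_preimage_matVec _ (convex_laminateCell hδ hs ht l)))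
  filter_upwards [h1] with x hx hxd
  set l := laminateLabel p δ s t (matVec Qᵀ x) with hl
  have hxl : x ∈ matVec Qᵀ ⁻¹' laminateCell p δ s t l :=
    (mem_laminateCell_iff hs ht l _).2 ⟨hxd, hl.symm⟩
  have hint : x ∈ interior (matVec Qᵀ ⁻¹' laminateCell p δ s t l) := by
    by_contra h
    exact hx l ⟨subset_closure hxl, h⟩
  have h2 : HasFDerivAt (fun y => matCLM (laminateGradient W Q M p δ s t l) y +
      laminateOffset p δ s l • matVec W (EuclideanSpace.single p 1))
      (matCLM (laminateGradient W Q M p δ s t l)) x :=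
    (matCLM (laminateGradient W Q M p δ s t l)).hasFDerivAt.add_const _
  refine h2.congr_of_eventuallyEq ?_
  filter_upwards [mem_interior_iff_mem_nhds.1 hint] with y hy
  exact laminateMap_eq hs ht (laminateCell_subset_closedCell l hy)

theorem matVec_matVec_transpose (hQ : Qᵀ * Q = 1) (x : Euc n) :
    matVec Q (matVec Qᵀ x) = x := by
  rw [← matVec_mul, mul_eq_one_comm.1 hQ, matVec_one]

theorem matVec_transpose_matVec (hQ : Qᵀ * Q = 1) (x : Euc n) :
    matVec Qᵀ (matVec Q x) = x := by
  rw [← matVec_mul, hQ, matVec_one]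

theorem image_matVec_eq_preimage (hQ : Qᵀ * Q = 1) (S : Set (Euc n)) :
    matVec Q '' S = matVec Qᵀ ⁻¹' S :=
  congrFun (Set.image_eq_preimage_of_inverse (matVec_transpose_matVec hQ)
    (matVec_matVec_transpose hQ)) S

theorem isDiamond_preimage_thinDiamond (hp : (p : ℕ) = 1) (hδ : 0 < δ) (hQ : Qᵀ * Q = 1)
    (hdet : Q.det = 1) : IsDiamond n δ (matVec Qᵀ ⁻¹' thinDiamond p δ) := by
  refine ⟨0, 1, Q, one_pos, hQ, hdet, ?_⟩
  simp only [one_smul, zero_add]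
  rw [baseDiamond_eq_thinDiamond hp hδ]
  exact (image_matVec_eq_preimage hQ _).symm

theorem continuous_laminateMap : Continuous (laminateMap W Q M p δ s t) :=
  (continuous_matVec M).add
    ((continuous_laminateProfile.comp (continuous_matVec Qᵀ)).smul continuous_const)

theorem isPiecewiseAffine_laminateMap (hδ : 0 < δ) (hs : 0 < s) (ht : 0 < t)
    (hQ : Qᵀ * Q = 1) :
    IsPiecewiseAffine (matVec Qᵀ ⁻¹' thinDiamond p δ) (laminateMap W Q M p δ s t) := by
  classical
  refine ⟨continuous_laminateMap.continuousOn, Fintype.card ((Fin n → Bool) × Bool), fun i =>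
    matVec Q '' simplexPolytope p δ s t ((Fintype.equivFin ((Fin n → Bool) × Bool)).symm i).1
      ((Fintype.equivFin ((Fin n → Bool) × Bool)).symm i).2, fun i => ?_, fun x hx => ?_,
    fun i => ?_⟩
  · beta_reduce
    generalize (Fintype.equivFin ((Fin n → Bool) × Bool)).symm i = o
    refine ⟨Finset.univ.image fun v => matVec Q
      (simplexVertex p δ (if o.2 then δ else 0) (s / (s + t)) o.1 v), ?_⟩
    rw [simplexPolytope, Finset.coe_image, Finset.coe_univ, Set.image_univ]
    have := (matCLM Q : Euc n →ₗ[ℝ] Euc n).image_convexHull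
      (Set.range (simplexVertex p δ (if o.2 then δ else 0) (s / (s + t)) o.1))
    rw [← Set.range_comp] at this
    exact this
  · obtain ⟨τ, b, h⟩ := thinDiamond_subset_iUnion_simplexPolytope hδ hs ht hx
    refine Set.mem_iUnion.2 ⟨Fintype.equivFin _ (τ, b), ?_⟩
    rw [Equiv.symm_apply_apply, image_matVec_eq_preimage hQ]
    exact h
  · obtain ⟨l, hl⟩ := simplexPolytope_subset_closedCell hδ hs ht
      ((Fintype.equivFin ((Fin n → Bool) × Bool)).symm i).1
      ((Fintype.equivFin ((Fin n → Bool) × Bool)).symm i).2 (p := p)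
    refine ⟨(matCLM (laminateGradient W Q M p δ s t l) : Euc n →ₗ[ℝ] Euc n),
      laminateOffset p δ s l • matVec W (EuclideanSpace.single p 1), fun x hx => ?_⟩
    refine laminateMap_eq hs ht (hl ?_)
    have := hx.1
    beta_reduce at this
    rwa [image_matVec_eq_preimage hQ] at this

theorem laminateMap_eq_of_mem_frontier (hs : 0 < s) (ht : 0 < t) {x : Euc n}
    (hx : x ∈ frontier (matVec Qᵀ ⁻¹' thinDiamond p δ)) :
    laminateMap W Q M p δ s t x = matVec M x := by
  have h1 : matVec Qᵀ ⁻¹' thinDiamond p δ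
      = {x | 1 * |matVec Qᵀ x p| + δ * transverseNorm p (matVec Qᵀ x) ≤ δ} := by
    ext x
    exact mem_weightedBall_oneWeight p 1 δ δ _
  have hc := continuous_matVec Qᵀ
  have hcp : Continuous fun x : Euc n => matVec Qᵀ x p :=
    (continuous_apply p).comp ((PiLp.continuous_ofLp 2 _).comp hc)
  have hct := (continuous_transverseNorm p).comp hc
  rw [h1] at hx
  have h2 := frontier_le_subset_eq (by fun_prop) continuous_const hx
  rw [laminateMap, laminateProfile_eq_zero hs ht (by simpa using h2), zero_smul, add_zero]

theorem measurableSet_preimage_diff :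
    MeasurableSet (matVec Qᵀ ⁻¹' thinDiamond p δ \ matVec Qᵀ ⁻¹' laminateCore p δ s t) :=
  (((isClosed_weightedBall _ _).preimage (continuous_matVec Qᵀ)).measurableSet).diff
    (((isClosed_weightedBall _ _).preimage (continuous_matVec Qᵀ)).measurableSet)

theorem volume_preimage_laminateCore (hs : 0 < s) (ht : 0 < t) (hQ : Qᵀ * Q = 1) :
    volume (matVec Qᵀ ⁻¹' laminateCore p δ s t)
      = ENNReal.ofReal (s / (s + t)) * volume (matVec Qᵀ ⁻¹' thinDiamond p δ) := by
  have hst := add_pos hs ht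
  have hθ : 0 < s / (s + t) := div_pos hs hst
  set A : Mat n := Q * Matrix.diagonal (oneWeight p ((s + t) / s) 1) * Qᵀ with hA
  have hdetQ : Q.det * Q.det = 1 := by
    have := congrArg Matrix.det hQ
    rwa [Matrix.det_mul, Matrix.det_transpose, Matrix.det_one] at this
  have hdet : A.det = (s + t) / s := by
    rw [hA, Matrix.det_mul, Matrix.det_mul, Matrix.det_transpose, Matrix.det_diagonal,
      mul_right_comm, hdetQ, one_mul]
    simp [oneWeight]
  have hset : matVec Qᵀ ⁻¹' laminateCore p δ s t
      = Matrix.toEuclideanLin A ⁻¹' (matVec Qᵀ ⁻¹' thinDiamond p δ) := by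
    ext x
    have h1 : matVec Qᵀ (Matrix.toEuclideanLin A x)
        = matVec (Matrix.diagonal (oneWeight p ((s + t) / s) 1)) (matVec Qᵀ x) := by
      change matVec Qᵀ (matVec A x) = _
      rw [hA, matVec_mul, matVec_mul, matVec_transpose_matVec hQ]
    rw [Set.mem_preimage, Set.mem_preimage, Set.mem_preimage, h1, laminateCore, thinDiamond,
      mem_weightedBall_oneWeight, mem_weightedBall_oneWeight]
    have h2 : transverseNorm p (matVec (Matrix.diagonal (oneWeight p ((s + t) / s) 1))
        (matVec Qᵀ x)) = transverseNorm p (matVec Qᵀ x) :=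
      Finset.sum_congr rfl fun i hi => by
        rw [matVec_diagonal_apply, oneWeight, if_neg (Finset.ne_of_mem_erase hi), one_mul]
    rw [h2, matVec_diagonal_apply, oneWeight, if_pos rfl, abs_mul, abs_of_pos (div_pos hst hs)]
    rw [← mul_le_mul_iff_right₀ hs (c := δ)]
    have h3 : s * (1 * ((s + t) / s * |matVec Qᵀ x p|) + δ * transverseNorm p (matVec Qᵀ x))
        = (s + t) * |matVec Qᵀ x p| + s * δ * transverseNorm p (matVec Qᵀ x) := by
      field_simp
    rw [h3]
  have hdet' : LinearMap.det (Matrix.toEuclideanLin A) = (s + t) / s := by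
    rw [← hdet]; exact LinearMap.det_toLpLin 2 A
  rw [hset, Measure.addHaar_preimage_linearMap _ (by rw [hdet']; positivity), hdet', inv_div,
    abs_of_pos hθ]

theorem le_volume_preimage_diff {c : ℝ} (hs : 0 < s) (ht : 0 < t) (hQ : Qᵀ * Q = 1)
    (hc : s / (s + t) ≤ c) (hfin : volume (matVec Qᵀ ⁻¹' thinDiamond p δ) ≠ ∞) :
    ENNReal.ofReal (1 - c) * volume (matVec Qᵀ ⁻¹' thinDiamond p δ) ≤
      volume (matVec Qᵀ ⁻¹' thinDiamond p δ \ matVec Qᵀ ⁻¹' laminateCore p δ s t) := by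
  refine le_trans ?_ (le_measure_sdiff (μ := volume))
  rw [volume_preimage_laminateCore hs ht hQ]
  calc _ ≤ (1 - ENNReal.ofReal (s / (s + t))) * volume (matVec Qᵀ ⁻¹' thinDiamond p δ) := by
        gcongr
        rw [← ENNReal.ofReal_one, ← ENNReal.ofReal_sub _ (div_pos hs (add_pos hs ht)).le]
        exact ENNReal.ofReal_le_ofReal (by linarith)
    _ = _ := by rw [ENNReal.sub_mul fun _ _ => hfin, one_mul]

theorem isBounded_preimage_thinDiamond (hδ : 0 < δ) (hQ : Qᵀ * Q = 1) :
    Bornology.IsBounded (matVec Qᵀ ⁻¹' thinDiamond p δ) := by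
  refine isBounded_iff_forall_norm_le.2
    ⟨‖matCLM Q‖ * ‖(WithLp.toLp 2 fun _ => 1 + δ : Euc n)‖, fun x hx => ?_⟩
  have h1 : ‖matVec Qᵀ x‖ ≤ ‖(WithLp.toLp 2 fun _ => 1 + δ : Euc n)‖ := by
    refine norm_le_norm_of_abs_le fun i => ?_
    have h2 := (mem_weightedBall_oneWeight p 1 δ δ _).1 hx
    have h3 := transverseNorm_nonneg p (matVec Qᵀ x)
    have h4 := abs_nonneg (matVec Qᵀ x p)
    have hy : |(WithLp.toLp 2 fun _ => 1 + δ : Euc n) i| = 1 + δ := abs_of_pos (by linarith)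
    rw [hy]
    by_cases hi : i = p
    · rw [hi]
      nlinarith [mul_nonneg hδ.le h3]
    · have h5 : |matVec Qᵀ x i| ≤ transverseNorm p (matVec Qᵀ x) :=
        Finset.single_le_sum (f := fun i => |matVec Qᵀ x i|) (fun _ _ => abs_nonneg _)
          (Finset.mem_erase.2 ⟨hi, Finset.mem_univ i⟩)
      have h6 : transverseNorm p (matVec Qᵀ x) ≤ 1 := by
        by_contra! h
        nlinarith
      linarith
  calc ‖x‖ = ‖matCLM Q (matVec Qᵀ x)‖ := by
        conv_lhs => rw [← matVec_matVec_transpose hQ x]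
        rfl
    _ ≤ ‖matCLM Q‖ * ‖matVec Qᵀ x‖ := (matCLM Q).le_opNorm _
    _ ≤ _ := by gcongr

theorem hausdorffMeasure_frontier_lt_top_of_convex {K : Set (Euc n)} (hK : Convex ℝ K)
    (hb : Bornology.IsBounded K) (hn : 0 < n) : μH[(n : ℝ) - 1] (frontier K) < ∞ := by
  obtain ⟨m, rfl⟩ := Nat.exists_eq_succ_of_ne_zero hn.ne'
  obtain ⟨R, hR⟩ := isBounded_iff_forall_norm_le.1 hb
  have h1 := hausdorffMeasure_frontier_cube_lt_top m R
  rw [Nat.cast_succ, add_sub_cancel_right]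
  refine (hK.hausdorffMeasure_frontier_mono
    (L := {x : Euc (m + 1) | ∀ i, |x i| ≤ R})
    (fun x hx i => (abs_coord_le_norm x i).trans (hR x hx)) ?_ ?_ m.cast_nonneg).trans_lt h1
  · rw [Set.ofPred_forall]
    exact isClosed_iInter fun i => isClosed_le (by fun_prop) continuous_const
  · refine isBounded_iff_forall_norm_le.2 ⟨‖(WithLp.toLp 2 fun _ => R : Euc (m + 1))‖,
      fun x hx => norm_le_norm_of_abs_le fun i => ?_⟩
    exact (hx i).trans (le_abs_self R)

/-- The boundaries of the level sets of the gradient of the replacement have controlled measure. -/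
theorem sum_Per_laminate_le [DecidableEq (Mat n)] (hδ : 0 < δ) (hs : 0 < s) (ht : 0 < t)
    (hQ : Qᵀ * Q = 1) (G : Option (Fin n → Bool) → Mat n) :
    ∑ v ∈ Finset.univ.image G, Per {x ∈ matVec Qᵀ ⁻¹' thinDiamond p δ |
      G (laminateLabel p δ s t (matVec Qᵀ x)) = v}
      ≤ 2 ^ (n + 2) * Per (matVec Qᵀ ⁻¹' thinDiamond p δ) := by
  have hn : 0 < n := (Nat.zero_le _).trans_lt p.2
  have hn' : (0 : ℝ) ≤ n - 1 := by
    have : (1 : ℝ) ≤ n := by exact_mod_cast hn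
    linarith
  set Ω := matVec Qᵀ ⁻¹' thinDiamond p δ with hΩ
  have hconv : Convex ℝ Ω := convex_preimage_matVec _ (convex_thinDiamond hδ)
  have hbdd : Bornology.IsBounded Ω := isBounded_preimage_thinDiamond hδ hQ
  have hcl : IsClosed Ω := (isClosed_weightedBall _ _).preimage (continuous_matVec Qᵀ)
  have hfin := hausdorffMeasure_frontier_lt_top_of_convex hconv hbdd hn
  have hle : ∀ v, Per {x ∈ Ω | G (laminateLabel p δ s t (matVec Qᵀ x)) = v}
      ≤ ({l | G l = v} : Finset (Option (Fin n → Bool))).card * Per Ω := by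
    intro v
    have h1 : {x ∈ Ω | G (laminateLabel p δ s t (matVec Qᵀ x)) = v} =
        ⋃ l ∈ ({l | G l = v} : Finset (Option (Fin n → Bool))),
          matVec Qᵀ ⁻¹' laminateCell p δ s t l := by
      ext x
      simp [mem_laminateCell_iff hs ht, hΩ]
    have h2 : μH[(n : ℝ) - 1] (frontier {x ∈ Ω | G (laminateLabel p δ s t (matVec Qᵀ x)) = v}) ≤
        ({l | G l = v} : Finset (Option (Fin n → Bool))).card * μH[(n : ℝ) - 1] (frontier Ω) := by
      rw [h1]
      refine (measure_mono (frontier_finset_biUnion_subset _ _)).trans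
        ((measure_biUnion_finset_le _ _).trans ?_)
      rw [← nsmul_eq_mul]
      refine Finset.sum_le_card_nsmul _ _ _ fun l _ => ?_
      exact (convex_preimage_matVec _ (convex_laminateCell hδ hs ht l)
        ).hausdorffMeasure_frontier_mono
        (fun x hx => ((mem_laminateCell_iff hs ht l _).1 hx).1) hcl hbdd hn'
    have h3 := ENNReal.toReal_mono (ENNReal.mul_ne_top (ENNReal.natCast_ne_top _) hfin.ne) h2
    rwa [ENNReal.toReal_mul, ENNReal.toReal_natCast] at h3
  refine (Finset.sum_le_sum fun v _ => hle v).trans ?_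
  rw [← Finset.sum_mul]
  refine mul_le_mul_of_nonneg_right ?_ ENNReal.toReal_nonneg
  rw [← Nat.cast_sum, ← Finset.card_eq_sum_card_image, Finset.card_univ, Fintype.card_option,
    Fintype.card_fun, Fintype.card_bool, Fintype.card_fin]
  push_cast
  have : (1 : ℝ) ≤ 2 ^ n := one_le_pow₀ one_le_two
  rw [pow_add]
  linarith

theorem abs_apply_le_one_of_transpose_mul_self {A : Mat n} (hA : Aᵀ * A = 1) (i j : Fin n) :
    |A i j| ≤ 1 := by
  have h1 := congrFun (congrFun hA j) j
  rw [Matrix.mul_apply, Matrix.one_apply_eq] at h1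
  have h2 := Finset.single_le_sum (f := fun i => Aᵀ j i * A i j)
    (fun i _ => mul_self_nonneg (A i j)) (Finset.mem_univ i)
  rw [← sq_le_one_iff_abs_le_one, sq]
  exact h2.trans_eq h1

theorem frobNorm_le {A : Mat n} {c : ℝ} (hc : 0 ≤ c) (h : ∀ i j, |A i j| ≤ c) :
    frobNorm A ≤ n * c := by
  refine Real.sqrt_le_iff.2 ⟨by positivity, ?_⟩
  calc ∑ i, ∑ j, A i j ^ 2 ≤ ∑ _i : Fin n, ∑ _j : Fin n, c ^ 2 := by
        refine Finset.sum_le_sum fun i _ => Finset.sum_le_sum fun j _ => ?_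
        rw [← sq_abs]
        exact pow_le_pow_left₀ (abs_nonneg _) (h i j) 2
    _ = (n * c) ^ 2 := by simp; ring

theorem abs_laminateSlope_some (hδ : 0 < δ) (hs : 0 < s) (τ : Fin n → Bool) {i : Fin n}
    (hi : i ≠ p) : |laminateSlope p δ s t (some τ) i| = s * δ := by
  simp only [laminateSlope, if_neg hi]
  rw [abs_mul, abs_mul (boolSign _), abs_boolSign, abs_boolSign,
    one_mul, mul_one, abs_of_pos (mul_pos hs hδ)]

theorem frobNorm_laminateGradient_sub_le (hδ : 0 < δ) (hδ1 : δ ≤ 1) (hs : 0 < s)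
    (hW : Wᵀ * W = 1) (hQ : Qᵀ * Q = 1) (τ : Fin n → Bool) :
    frobNorm (laminateGradient W Q M p δ s t (some τ) - M) ≤ n ^ 2 * s := by
  have h1 : ∀ i, |laminateSlope p δ s t (some τ) i| ≤ s := by
    intro i
    by_cases hi : i = p
    · simp [laminateSlope, hi, abs_of_pos hs]
    · rw [abs_laminateSlope_some hδ hs τ hi]
      exact mul_le_of_le_one_right hs.le hδ1
  rw [laminateGradient, add_sub_cancel_left, sq, mul_assoc (n : ℝ)]
  refine frobNorm_le (by positivity) fun a b => ?_
  have h2 : (W * Matrix.vecMulVec (Pi.single p 1) (laminateSlope p δ s t (some τ)) * Qᵀ) a b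
      = W a p * ∑ i, laminateSlope p δ s t (some τ) i * Q b i := by
    rw [Matrix.mul_vecMulVec, Matrix.vecMulVec_mul, Matrix.vecMulVec_apply,
      Matrix.mulVec_single_one]
    simp [Matrix.vecMul, dotProduct]
  rw [h2, abs_mul]
  calc |W a p| * |∑ i, laminateSlope p δ s t (some τ) i * Q b i|
      ≤ 1 * ∑ _i : Fin n, s := by
        refine mul_le_mul (abs_apply_le_one_of_transpose_mul_self hW a p)
          ((Finset.abs_sum_le_sum_abs _ _).trans (Finset.sum_le_sum fun i _ => ?_))
          (abs_nonneg _) zero_le_one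
        rw [abs_mul]
        exact (mul_le_mul (h1 i) (abs_apply_le_one_of_transpose_mul_self hQ b i) (abs_nonneg _)
          hs.le).trans_eq (mul_one s)
    _ = n * s := by simp

theorem laminateGradient_eq (η : Fin n → ℝ) (l : Option (Fin n → Bool)) :
    laminateGradient W Q (W * Matrix.diagonal η * Qᵀ) p δ s t l =
      W * (Matrix.diagonal (Function.update η p (η p + laminateSlope p δ s t l p)) +
        Matrix.vecMulVec (Pi.single p 1) (Function.update (laminateSlope p δ s t l) p 0)) * Qᵀ := by
  rw [laminateGradient, ← Matrix.add_mul, ← Matrix.mul_add]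
  congr 2
  ext a b
  simp only [Matrix.add_apply, Matrix.diagonal_apply, Matrix.vecMulVec_apply, Pi.single_apply,
    Function.update_apply]
  split_ifs <;> simp_all

end Replacement

/-- The replacement construction associated with the sets `U_k^j` for `O(n)`,
`n ∈ {2,3}`, on a diamond-shaped domain of aspect ratio `1:δ` (resp. `1:δ:1`) with
`δ = κ₀2^{−10}/n`, `κ₀ = 1/4`; the constant `C ≥ 1` is independent of `k`, `j`, `M`. -/
theorem On_replacement_Uset (n : ℕ) (hn : n = 2 ∨ n = 3) :
    ∃ C : ℝ, 1 ≤ C ∧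
      ∀ k : ℕ, 1 ≤ k → ∀ j : ℕ, j < n →
        ∀ M : Mat n, matOpNorm M < 1 → M ∈ Uset n k j →
          ∃ (Ωd : Set (Euc n)) (w : Euc n → Euc n) (g : Euc n → Mat n)
            (star : Set (Euc n)),
            IsDiamond n ((1/4 : ℝ) * (1/2 : ℝ) ^ 10 / n) Ωd ∧
            IsPiecewiseAffine Ωd w ∧
            star ⊆ Ωd ∧ MeasurableSet star ∧
            (∀ᵐ x, x ∈ Ωd → HasFDerivAt w (matCLM (g x)) x) ∧
            (∀ᵐ x, x ∈ Ωd → g x ∈ Uset n k (j + 1)) ∧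
            (∀ᵐ x, x ∈ star → frobNorm (g x - M) ≤ C * (1/2 : ℝ) ^ k) ∧
            (∀ x ∈ frontier Ωd, w x = matVec M x) ∧
            ENNReal.ofReal (1 - C * (1/2 : ℝ) ^ k) * volume Ωd ≤ volume star ∧
            ∃ V : Finset (Mat n), (∀ᵐ x, x ∈ Ωd → g x ∈ V) ∧
              ∑ v ∈ V, Per {x ∈ Ωd | g x = v} ≤ 2 ^ (n + 2) * Per Ωd := by
  classical
  have hn2 : 2 ≤ n := by omega
  have hn3 : n ≤ 3 := by omega
  have hn2' : (2 : ℝ) ≤ n := by exact_mod_cast hn2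
  have hn3' : (n : ℝ) ≤ 3 := by exact_mod_cast hn3
  refine ⟨n ^ 2, by nlinarith, fun k hk j hj M _ hM => ?_⟩
  obtain ⟨μ, hμ, hμ1, hμ2⟩ := hM
  set p : Fin n := ⟨1, hn2⟩ with hp
  set q : Fin n := ⟨j, hj⟩ with hq
  obtain ⟨W, Q, hW, hQ, hdet, rfl⟩ := hμ.exists_rotation (Equiv.swap p q) p
  set η : Fin n → ℝ := μ ∘ Equiv.swap p q with hη
  set M : Mat n := W * Matrix.diagonal η * Qᵀ with hM
  have hηp : η p = μ q := by rw [hη, Function.comp_apply, Equiv.swap_apply_left]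
  set δ : ℝ := (1/4 : ℝ) * (1/2 : ℝ) ^ 10 / n with hδ_def
  have hn0 : (0 : ℝ) < n := by linarith
  have hδ : 0 < δ := by positivity
  have hδn : δ * (4096 * n) = 1 := by rw [hδ_def]; field_simp; norm_num
  have hδ1 : δ ≤ 1 := by nlinarith
  have hd := dk_pos k
  have hd8 := dk_le hk
  have hdk : 4 * dk k = (1 / 2 : ℝ) ^ k := by rw [dk, pow_add]; ring
  have hρ : (j : ℝ) / n ≤ 1 := (div_le_one hn0).2 (by exact_mod_cast hj.le)
  have hρ0 : 0 ≤ (j : ℝ) / n := by positivity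
  have hμq := hμ2 q le_rfl
  rw [← hηp, Iset, Set.mem_Icc, ck_eq, dk_pred hk] at hμq
  have hρd : (j : ℝ) / n * dk k ≤ dk k := mul_le_of_le_one_left hd.le hρ
  set s : ℝ := ck k - η p with hs_def
  set t : ℝ := ck k + η p with ht_def
  have hck := ck_eq k
  have hs : 0 < s := by linarith
  have ht : 0 < t := by linarith
  have hs4 : s ≤ (1 / 2 : ℝ) ^ k := by rw [← hdk]; linarith
  have hst : s / (s + t) ≤ n ^ 2 * (1 / 2 : ℝ) ^ k := by
    have h1 : (1 : ℝ) ≤ s + t := by linarith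
    calc s / (s + t) ≤ s := div_le_self hs.le h1
      _ ≤ 1 * (1 / 2 : ℝ) ^ k := by rwa [one_mul]
      _ ≤ _ := by gcongr; nlinarith
  set G := laminateGradient W Q M p δ s t with hG
  have hU : ∀ l, G l ∈ Uset n k (j + 1) := by
    intro l
    rw [hG, hM, laminateGradient_eq]
    refine mul_mul_transpose_mem_Uset hW hQ (diagonal_add_vecMulVec_mem_Uset hk hj
      (T := (Finset.Iic q).map (Equiv.swap p q).toEmbedding) ?_ ?_ ?_ ?_ ?_)
    · rw [Finset.card_map, Fin.card_Iic]
    · rw [Function.update_self]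
      cases l with
      | none =>
        rw [laminateSlope, Pi.single_eq_same, ht_def, abs_of_nonpos] <;> linarith
      | some τ =>
        simp only [laminateSlope, if_true]
        rw [hs_def, abs_of_nonneg] <;> linarith
    · intro i hi hip
      rw [Function.update_of_ne hip]
      rw [Finset.mem_map_equiv, Equiv.symm_swap, Finset.mem_Iic] at hi
      refine hμ1 _ (lt_of_le_of_ne hi fun h => hip ?_)
      have h1 : Equiv.swap p q i = q := Fin.ext h
      rwa [Equiv.swap_apply_eq_iff, Equiv.swap_apply_right] at h1
    · intro i hi
      rw [Finset.mem_map_equiv, Equiv.symm_swap, Finset.mem_Iic, not_le] at hi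
      have hip : i ≠ p := by
        rintro rfl
        rw [Equiv.swap_apply_left] at hi
        exact lt_irrefl _ hi
      rw [Function.update_of_ne hip]
      exact hμ2 _ hi.le
    · intro i
      rw [Function.update_apply]
      have h1 : 0 ≤ dk k / (4 * n ^ 2) := by positivity
      split_ifs with hi
      · rwa [abs_zero]
      · cases l with
        | none => simpa [laminateSlope, hi] using h1
        | some τ =>
          rw [abs_laminateSlope_some hδ hs τ hi, le_div_iff₀ (by positivity)]
          calc s * δ * (4 * n ^ 2) = s * (δ * (4096 * n)) * (n / 1024) := by ring
            _ ≤ 4 * dk k * 1 * (1 / 4) := by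
              rw [hδn, hdk, mul_one, mul_one]
              exact mul_le_mul hs4 (by linarith) (by positivity) (by positivity)
            _ = dk k := by ring
  refine ⟨matVec Qᵀ ⁻¹' thinDiamond p δ, laminateMap W Q M p δ s t,
    fun x => G (laminateLabel p δ s t (matVec Qᵀ x)),
    matVec Qᵀ ⁻¹' thinDiamond p δ \ matVec Qᵀ ⁻¹' laminateCore p δ s t,
    isDiamond_preimage_thinDiamond rfl hδ hQ hdet, isPiecewiseAffine_laminateMap hδ hs ht hQ,
    Set.sdiff_subset, measurableSet_preimage_diff, ae_hasFDerivAt_laminateMap hδ hs ht,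
    .of_forall fun x _ => hU _, .of_forall fun x hx => ?_,
    fun x hx => laminateMap_eq_of_mem_frontier hs ht hx,
    le_volume_preimage_diff hs ht hQ hst (isBounded_preimage_thinDiamond hδ hQ).measure_lt_top.ne,
    Finset.univ.image G, .of_forall fun x _ => Finset.mem_image_of_mem _ (Finset.mem_univ _),
    sum_Per_laminate_le hδ hs ht hQ G⟩
  have hx' : matVec Qᵀ x ∉ laminateCore p δ s t := hx.2
  simp only [laminateLabel, if_neg hx']
  exact (frobNorm_laminateGradient_sub_le hδ hδ1 hs hW hQ _).trans (by gcongr)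
end
end

section
/- Let n ≥ 2 and let e₁, e₂ ∈ ℝ^{n×n} be symmetric with tr(e₁) = tr(e₂) = 0 and e₁ ≠ e₂. Then the following statements are equivalent: (i) there exist a ∈ ℝⁿ ∖ {0} and b ∈ S^{n−1} such that e₁ − e₂ = a ⊙ b; (ii) there exist matrices M₁, M₂ ∈ ℝ^{n×n} and vectors a ∈ ℝⁿ ∖ {0}, b ∈ S^{n−1} such that M₁ − M₂ = a ⊗ b and the symmetric parts satisfy e(M₁) = e₁ and e(M₂) = e₂; (iii) rank(e₁ − e₂) ≤ 2. -/
noncomputable section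
open MeasureTheory Set ENNReal Matrix

/-- The symmetrized tensor product `a ⊙ b = (1/2)(a ⊗ b + b ⊗ a)`. -/
def symProd {n : ℕ} (a b : Euc n) : Mat n :=
  (1/2 : ℝ) • (Matrix.vecMulVec (fun i => a i) (fun j => b j) +
    Matrix.vecMulVec (fun i => b i) (fun j => a j))

/-- The symmetric part `e(M) = (1/2)(M + Mᵀ)` of a matrix. -/
def symPart {n : ℕ} (M : Mat n) : Mat n := (1/2 : ℝ) • (M + Mᵀ)

/-- Spectral decomposition of a real symmetric matrix, entrywise. -/
theorem apply_eq_sum_eigenvalues {n : ℕ} {D : Mat n} (hD : D.IsHermitian) (i j : Fin n) :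
    D i j = ∑ k, hD.eigenvalues k * hD.eigenvectorBasis k i * hD.eigenvectorBasis k j := by
  conv_lhs => rw [hD.spectral_theorem, Unitary.conjStarAlgAut_apply]
  rw [Matrix.mul_apply]
  simp only [Matrix.mul_diagonal, Matrix.star_apply,
    Matrix.IsHermitian.eigenvectorUnitary_apply, Function.comp_apply, RCLike.ofReal_real_eq_id,
    id_eq, star_trivial]
  exact Finset.sum_congr rfl fun k _ => by ring

/-- A nonzero symmetrized product can be rewritten with its second factor normalized. -/
theorem exists_unit_symProd {n : ℕ} {a c : Euc n} (h : symProd a c ≠ 0) :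
    ∃ a' b : Euc n, a' ≠ 0 ∧ ‖b‖ = 1 ∧ symProd a c = symProd a' b := by
  have ha : a ≠ 0 := by
    rintro rfl
    exact h (by ext i j; simp [symProd, Matrix.vecMulVec_apply])
  have hc : c ≠ 0 := by
    rintro rfl
    exact h (by ext i j; simp [symProd, Matrix.vecMulVec_apply])
  have hc' : ‖c‖ ≠ 0 := norm_ne_zero_iff.mpr hc
  refine ⟨‖c‖ • a, ‖c‖⁻¹ • c, smul_ne_zero hc' ha, ?_, ?_⟩
  · rw [norm_smul, norm_inv, norm_norm, inv_mul_cancel₀ hc']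
  · ext i j
    simp only [symProd, Matrix.smul_apply, Matrix.add_apply, Matrix.vecMulVec_apply,
      PiLp.smul_apply, smul_eq_mul]
    field_simp

theorem rank_symProd_le {n : ℕ} (a b : Euc n) : (symProd a b).rank ≤ 2 := by
  have h : symProd a b = (Matrix.of fun i (k : Fin 2) => ![a i, b i] k) *
      Matrix.of fun (k : Fin 2) j => (1 / 2 : ℝ) * ![b j, a j] k := by
    ext i j
    simp only [symProd, Matrix.smul_apply, Matrix.add_apply, Matrix.vecMulVec_apply,
      Matrix.mul_apply, Fin.sum_univ_two, Matrix.of_apply, Matrix.cons_val_zero,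
      Matrix.cons_val_one, smul_eq_mul]
    ring
  rw [h]
  exact (Matrix.rank_mul_le_left _ _).trans (Matrix.rank_le_width _)

/-- A trace-free symmetric matrix of rank at most two has eigenvalues `μ`, `-μ` and otherwise zero,
hence is a symmetrized product. -/
theorem exists_eq_symProd {n : ℕ} {D : Mat n} (hD : D.IsHermitian) (htr : D.trace = 0)
    (hrank : D.rank ≤ 2) (hne : D ≠ 0) : ∃ a c : Euc n, D = symProd a c := by
  have hsum : ∑ k, hD.eigenvalues k = 0 := by
    simpa [htr] using hD.trace_eq_sum_eigenvalues.symm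
  obtain ⟨p, hp⟩ : ∃ p, hD.eigenvalues p ≠ 0 := by
    by_contra! h
    exact hne (by ext i j; simp [apply_eq_sum_eigenvalues hD, h])
  obtain ⟨q, hqp, hq⟩ : ∃ q, q ≠ p ∧ hD.eigenvalues q ≠ 0 := by
    by_contra! h
    rw [Fintype.sum_eq_single p h] at hsum
    exact hp hsum
  have hzero : ∀ k, k ≠ p ∧ k ≠ q → hD.eigenvalues k = 0 := by
    rintro k ⟨hkp, hkq⟩
    by_contra hk
    rw [hD.rank_eq_card_non_zero_eigs, Fintype.card_subtype] at hrank
    have hsub : ({p, q, k} : Finset (Fin n)) ⊆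
        Finset.univ.filter fun i => hD.eigenvalues i ≠ 0 := by
      intro x hx
      simp only [Finset.mem_insert, Finset.mem_singleton] at hx
      rcases hx with rfl | rfl | rfl <;> simpa
    have hcard := Finset.card_le_card hsub
    rw [Finset.card_eq_three.mpr ⟨p, q, k, hqp.symm, hkp.symm, hkq.symm, rfl⟩] at hcard
    omega
  have hneg : hD.eigenvalues q = -hD.eigenvalues p := by
    rw [Fintype.sum_eq_add p q hqp.symm hzero] at hsum
    linarith
  refine ⟨hD.eigenvalues p • (hD.eigenvectorBasis p + hD.eigenvectorBasis q),
    hD.eigenvectorBasis p - hD.eigenvectorBasis q, ?_⟩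
  ext i j
  rw [apply_eq_sum_eigenvalues hD, Fintype.sum_eq_add p q hqp.symm
    (fun k hk => by rw [hzero k hk]; ring), hneg]
  simp only [symProd, Matrix.smul_apply, Matrix.add_apply, Matrix.vecMulVec_apply,
    PiLp.smul_apply, PiLp.add_apply, PiLp.sub_apply, smul_eq_mul]
  ring

/-- Rank-one versus symmetrized rank-one connectedness: for symmetric trace-free
`e₁ ≠ e₂` the following are equivalent: (i) `e₁ − e₂ = a ⊙ b`; (ii) there are
`M₁, M₂` with `M₁ − M₂ = a ⊗ b` and symmetric parts `e₁, e₂`; (iii) `rank(e₁−e₂) ≤ 2`. -/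
theorem symmetrized_rank_one (n : ℕ) (hn : 2 ≤ n) (e₁ e₂ : Mat n)
    (h₁ : e₁ᵀ = e₁) (h₂ : e₂ᵀ = e₂)
    (ht₁ : Matrix.trace e₁ = 0) (ht₂ : Matrix.trace e₂ = 0) (hne : e₁ ≠ e₂) :
    List.TFAE
      [(∃ (a b : Euc n), a ≠ 0 ∧ ‖b‖ = 1 ∧ e₁ - e₂ = symProd a b),
       (∃ (M₁ M₂ : Mat n) (a b : Euc n), a ≠ 0 ∧ ‖b‖ = 1 ∧
          M₁ - M₂ = Matrix.vecMulVec (fun i => a i) (fun j => b j) ∧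
          symPart M₁ = e₁ ∧ symPart M₂ = e₂),
       ((e₁ - e₂).rank ≤ 2)] := by
  tfae_have 1 → 2 := by
    rintro ⟨a, b, ha, hb, h⟩
    refine ⟨e₂ + Matrix.vecMulVec (fun i => a i) (fun j => b j),
      e₂, a, b, ha, hb, add_sub_cancel_left _ _, ?_, ?_⟩
    · rw [eq_add_of_sub_eq h]
      ext i j
      have hs : e₂ j i = e₂ i j := congrFun (congrFun h₂ i) j
      simp only [symPart, symProd, Matrix.smul_apply, Matrix.add_apply, Matrix.transpose_apply,
        Matrix.vecMulVec_apply, smul_eq_mul, hs]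
      ring
    · rw [symPart, h₂, ← two_smul ℝ, smul_smul]
      norm_num
  tfae_have 2 → 1 := by
    rintro ⟨M₁, M₂, a, b, ha, hb, h, rfl, rfl⟩
    refine ⟨a, b, ha, hb, ?_⟩
    rw [eq_add_of_sub_eq h]
    ext i j
    simp only [symPart, symProd, Matrix.smul_apply, Matrix.add_apply, Matrix.sub_apply,
      Matrix.transpose_apply, Matrix.vecMulVec_apply, smul_eq_mul]
    ring
  tfae_have 1 → 3 := by
    rintro ⟨a, b, -, -, h⟩
    exact h ▸ rank_symProd_le a b
  tfae_have 3 → 1 := by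
    intro hrank
    have hD : (e₁ - e₂).IsHermitian := by
      rw [Matrix.IsHermitian, Matrix.conjTranspose_eq_transpose_of_trivial,
        Matrix.transpose_sub, h₁, h₂]
    have hne' : e₁ - e₂ ≠ 0 := sub_ne_zero.mpr hne
    obtain ⟨a, c, h⟩ := exists_eq_symProd hD (by rw [Matrix.trace_sub, ht₁, ht₂, sub_zero])
      hrank hne'
    rw [h] at hne' ⊢
    exact exists_unit_symProd hne'
  tfae_finish
end
end

section
/- Let K̃_h = {e^{(1)}, e^{(2)}, e^{(3)}} ⊂ ℝ^{2×2}_{sym} be the hexagonal-to-rhombic strains and K̃_co = {e^{(1)},…,e^{(6)}} ⊂ ℝ^{3×3}_{sym} the cubic-to-orthorhombic strains (with fixed parameter δ > 0). Then: (a) K̃_h^{lc,sym} = conv(K̃_h) with K̃_h^{lc,sym} = R_{2,sym}(K̃_h), and K̃_co^{lc,sym} = conv(K̃_co) with K̃_co^{lc,sym} = R_{5,sym}(K̃_co); (b) the affine dimension of conv(K̃_h) is 2 and that of conv(K̃_co) is 5; (c) for K = K̃_h + Skew(2) (respectively K = K̃_co + Skew(3)) one has conv(K) = K^{lc} = K̃^{lc,sym}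 + Skew(n) with n = 2 (respectively n = 3). -/
noncomputable section
open MeasureTheory Set ENNReal Matrix Pointwise

/-- The symmetrized laminates of order at most `l`. -/
def symLamSets {n : ℕ} (K : Set (Mat n)) : ℕ → Set (Mat n)
  | 0 => K
  | (l + 1) => symLamSets K l ∪
      {M | ∃ A ∈ symLamSets K l, ∃ B ∈ symLamSets K l, ∃ t : ℝ, t ∈ Set.Ioo (0 : ℝ) 1 ∧
        (∃ (a b : Euc n), a ≠ 0 ∧ ‖b‖ = 1 ∧ A - B = symProd a b) ∧
        M = t • A + (1 - t) • B}

/-- The symmetrized lamination convex hull `K^{lc,sym} = ⋃_l R_{l,sym}(K)`. -/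
def symLamHull {n : ℕ} (K : Set (Mat n)) : Set (Mat n) := ⋃ l, symLamSets K l

/-- The laminates of order at most `l`. -/
def lamSets {n : ℕ} (K : Set (Mat n)) : ℕ → Set (Mat n)
  | 0 => K
  | (l + 1) => lamSets K l ∪
      {M | ∃ A ∈ lamSets K l, ∃ B ∈ lamSets K l, ∃ t : ℝ, t ∈ Set.Ioo (0 : ℝ) 1 ∧
        (A - B).rank = 1 ∧ M = t • A + (1 - t) • B}

/-- The lamination convex hull `K^{lc} = ⋃_l R_l(K)`. -/
def lamHull {n : ℕ} (K : Set (Mat n)) : Set (Mat n) := ⋃ l, lamSets K l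

/-- The skew-symmetric `n×n` matrices. -/
def skewSet (n : ℕ) : Set (Mat n) := {S : Mat n | Sᵀ = -S}

/-- The three strains of the hexagonal-to-rhombic transformation. -/
def Kh : Set (Mat 2) :=
  {!![(1 : ℝ), 0; 0, -1],
   !![(-1 : ℝ)/2, Real.sqrt 3 / 2; Real.sqrt 3 / 2, 1/2],
   !![(-1 : ℝ)/2, -(Real.sqrt 3) / 2; -(Real.sqrt 3) / 2, 1/2]}

/-- The six strains of the cubic-to-orthorhombic transformation (with parameter δ). -/
def Kco (δ : ℝ) : Set (Mat 3) :=
  {!![(1 : ℝ), δ, 0; δ, 1, 0; 0, 0, -2],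
   !![(1 : ℝ), -δ, 0; -δ, 1, 0; 0, 0, -2],
   !![(1 : ℝ), 0, δ; 0, -2, 0; δ, 0, 1],
   !![(1 : ℝ), 0, -δ; 0, -2, 0; -δ, 0, 1],
   !![(-2 : ℝ), 0, 0; 0, 1, δ; 0, δ, 1],
   !![(-2 : ℝ), 0, 0; 0, 1, -δ; 0, -δ, 1]}

/-- Two matrices are symmetrically compatible if they differ by some `a ⊙ b` with `a ≠ 0` and
`b` a unit vector. -/
def SymCompat {n : ℕ} (A B : Mat n) : Prop :=
  ∃ a b : Euc n, a ≠ 0 ∧ ‖b‖ = 1 ∧ A - B = symProd a b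

lemma symProd_smul_left {n : ℕ} (c : ℝ) (a b : Euc n) :
    symProd (c • a) b = c • symProd a b := by
  ext i j
  simp only [symProd, Matrix.smul_apply, Matrix.add_apply, Matrix.vecMulVec_apply,
    PiLp.smul_apply, smul_eq_mul]
  ring

lemma symProd_smul_smul {n : ℕ} (c d : ℝ) (a b : Euc n) :
    symProd (c • a) (d • b) = (c * d) • symProd a b := by
  ext i j
  simp only [symProd, Matrix.smul_apply, Matrix.add_apply, Matrix.vecMulVec_apply,
    PiLp.smul_apply, smul_eq_mul]
  ring

lemma SymCompat.of_ne_zero {n : ℕ} {A B : Mat n} {a b : Euc n} (ha : a ≠ 0) (hb : b ≠ 0)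
    (h : A - B = symProd a b) : SymCompat A B := by
  have hb' : ‖b‖ ≠ 0 := norm_ne_zero_iff.mpr hb
  refine ⟨‖b‖ • a, ‖b‖⁻¹ • b, smul_ne_zero hb' ha, ?_, ?_⟩
  · rw [norm_smul, norm_inv, norm_norm, inv_mul_cancel₀ hb']
  · rw [h, symProd_smul_smul, mul_inv_cancel₀ hb', one_smul]

lemma SymCompat.symm {n : ℕ} {A B : Mat n} (h : SymCompat A B) : SymCompat B A := by
  obtain ⟨a, b, ha, hb, hab⟩ := h
  refine ⟨(-1 : ℝ) • a, b, smul_ne_zero (by norm_num) ha, hb, ?_⟩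
  rw [symProd_smul_left, ← hab, neg_one_smul, neg_sub]

instance {n : ℕ} : Std.Symm (SymCompat (n := n)) := ⟨fun _ _ => SymCompat.symm⟩

lemma add_smul_sub_mem_convexHull_erase {E : Type*} [AddCommGroup E] [Module ℝ E]
    [DecidableEq E] {s : Finset E} {w : E → ℝ} (hw : ∀ y ∈ s, 0 ≤ w y)
    (hsum : ∑ y ∈ s, w y = 1) {p q : E} (hp : p ∈ s) (hq : q ∈ s) (hpq : p ≠ q) :
    ∑ y ∈ s, w y • y + w q • (p - q) ∈ convexHull ℝ (s.erase q : Set E) := by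
  have hp' : p ∈ s.erase q := Finset.mem_erase.mpr ⟨hpq, hp⟩
  rw [Finset.mem_convexHull']
  refine ⟨fun y => w y + if y = p then w q else 0, fun y hy => ?_, ?_, ?_⟩
  · have := hw y (Finset.mem_of_mem_erase hy)
    have := hw q hq
    dsimp only
    split_ifs <;> linarith
  · rw [Finset.sum_add_distrib, Finset.sum_ite_eq', if_pos hp', Finset.sum_erase_eq_sub hq, hsum]
    ring
  · simp only [add_smul, ite_smul, zero_smul]
    rw [Finset.sum_add_distrib, Finset.sum_ite_eq', if_pos hp', Finset.sum_erase_eq_sub hq,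
      smul_sub]
    abel

lemma symLamSets_subset_succ {n : ℕ} (K : Set (Mat n)) (l : ℕ) :
    symLamSets K l ⊆ symLamSets K (l + 1) := fun _ h => Or.inl h

lemma subset_symLamSets {n : ℕ} (K : Set (Mat n)) (l : ℕ) : K ⊆ symLamSets K l := by
  induction l with
  | zero => exact subset_rfl
  | succ l ih => exact ih.trans (symLamSets_subset_succ K l)

lemma symLamSets_subset_convexHull {n : ℕ} (K : Set (Mat n)) (l : ℕ) :
    symLamSets K l ⊆ convexHull ℝ K := by
  induction l with
  | zero => exact subset_convexHull ℝ K
  | succ l ih =>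
    rintro M (h | ⟨A, hA, B, hB, t, ht, -, rfl⟩)
    · exact ih h
    · exact convex_convexHull ℝ K (ih hA) (ih hB) ht.1.le (by linarith [ht.2]) (by ring)

lemma lamSets_subset_convexHull {n : ℕ} (K : Set (Mat n)) (l : ℕ) :
    lamSets K l ⊆ convexHull ℝ K := by
  induction l with
  | zero => exact subset_convexHull ℝ K
  | succ l ih =>
    rintro M (h | ⟨A, hA, B, hB, t, ht, -, rfl⟩)
    · exact ih h
    · exact convex_convexHull ℝ K (ih hA) (ih hB) ht.1.le (by linarith [ht.2]) (by ring)

/-- Points of a simplex with pairwise compatible vertices are laminates: move along an edge until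
a vertex drops out. -/
lemma convexHull_subset_symLamSets {n : ℕ} {K : Set (Mat n)} (hK : K.Pairwise SymCompat) (l : ℕ) :
    ∀ s : Finset (Mat n), (s : Set (Mat n)) ⊆ K → s.card ≤ l + 1 →
      convexHull ℝ (s : Set (Mat n)) ⊆ symLamSets K l := by
  classical
  induction l with
  | zero =>
    intro s hs hc
    have hsub : (s : Set (Mat n)).Subsingleton := Finset.card_le_one_iff_subsingleton.mp hc
    rw [hsub.convex.convexHull_eq]
    exact hs
  | succ l ih =>
    intro s hs hc M hM
    rcases Nat.lt_or_ge 1 s.card with h1 | h1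
    swap
    · exact symLamSets_subset_succ K l (ih s hs (by omega) hM)
    obtain ⟨p, hp, q, hq, hpq⟩ := Finset.one_lt_card.mp h1
    have key : ∀ x ∈ s, convexHull ℝ (s.erase x : Set (Mat n)) ⊆ symLamSets K l := fun x hx =>
      ih _ ((Finset.coe_subset.mpr (Finset.erase_subset x s)).trans hs)
        (by rw [Finset.card_erase_of_mem hx]; omega)
    obtain ⟨w, hw, hsum, rfl⟩ := Finset.mem_convexHull'.mp hM
    have hA := key q hq (add_smul_sub_mem_convexHull_erase hw hsum hp hq hpq)
    have hB := key p hp (add_smul_sub_mem_convexHull_erase hw hsum hq hp hpq.symm)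
    rcases (hw p hp).eq_or_lt with hp0 | hp0
    · rw [← hp0, zero_smul, add_zero] at hB
      exact Or.inl hB
    rcases (hw q hq).eq_or_lt with hq0 | hq0
    · rw [← hq0, zero_smul, add_zero] at hA
      exact Or.inl hA
    have hc0 : 0 < w p + w q := add_pos hp0 hq0
    obtain ⟨a, b, ha, hb, hab⟩ := hK (hs hp) (hs hq) hpq
    refine Or.inr ⟨_, hA, _, hB, w p / (w p + w q), ⟨by positivity, ?_⟩,
      ⟨(w p + w q) • a, b, smul_ne_zero hc0.ne' ha, hb, ?_⟩, ?_⟩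
    · rw [div_lt_one hc0]
      linarith
    · rw [symProd_smul_left, ← hab]
      module
    · have h2 : 1 - w p / (w p + w q) = w q / (w p + w q) := by
        field_simp
        ring
      have h3 : w p / (w p + w q) + w q / (w p + w q) = 1 := by
        field_simp
      rw [h2]
      generalize ∑ y ∈ s, w y • y = S
      calc S = (w p / (w p + w q) + w q / (w p + w q)) • S := by rw [h3, one_smul]
        _ = _ := by module

lemma symLamHull_eq_of_pairwise {n : ℕ} (s : Finset (Mat n))
    (hs : (s : Set (Mat n)).Pairwise SymCompat) (l : ℕ) (hl : s.card ≤ l + 1) :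
    symLamHull (s : Set (Mat n)) = convexHull ℝ (s : Set (Mat n)) ∧
      symLamHull (s : Set (Mat n)) = symLamSets (s : Set (Mat n)) l := by
  have h1 : symLamHull (s : Set (Mat n)) ⊆ convexHull ℝ (s : Set (Mat n)) :=
    iUnion_subset (symLamSets_subset_convexHull _)
  have h2 := convexHull_subset_symLamSets hs l s subset_rfl hl
  have h3 : symLamSets (s : Set (Mat n)) l ⊆ symLamHull (s : Set (Mat n)) :=
    subset_iUnion (symLamSets (s : Set (Mat n))) l
  exact ⟨h1.antisymm (h2.trans h3), (h1.trans h2).antisymm h3⟩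

lemma rank_vecMulVec_eq_one {n : ℕ} {a b : Euc n} (ha : a ≠ 0) (hb : b ≠ 0) :
    (Matrix.vecMulVec (fun i => a i) (fun j => b j)).rank = 1 := by
  refine le_antisymm (Matrix.rank_vecMulVec_le _ _) (Nat.one_le_iff_ne_zero.mpr fun h => ?_)
  rw [Matrix.rank, Submodule.finrank_eq_zero, LinearMap.range_eq_bot,
    ← Matrix.toLin'_apply', LinearEquiv.map_eq_zero_iff] at h
  obtain ⟨i, hi⟩ : ∃ i, a i ≠ 0 := by
    by_contra! hc
    exact ha (by ext i; simpa using hc i)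
  obtain ⟨j, hj⟩ : ∃ j, b j ≠ 0 := by
    by_contra! hc
    exact hb (by ext j; simpa using hc j)
  have := congrFun (congrFun h i) j
  rw [Matrix.vecMulVec_apply] at this
  exact mul_ne_zero hi hj this

lemma convex_skewSet (n : ℕ) : Convex ℝ (skewSet n) := by
  intro A hA B hB s t _ _ _
  simp only [skewSet, mem_ofPred_eq] at *
  rw [Matrix.transpose_add, Matrix.transpose_smul, Matrix.transpose_smul, hA, hB]
  module

lemma add_mem_lamSets {n : ℕ} (K : Set (Mat n)) (l : ℕ) :
    ∀ M ∈ symLamSets K l, ∀ W ∈ skewSet n, M + W ∈ lamSets (K + skewSet n) l := by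
  induction l with
  | zero => exact fun M hM W hW => Set.add_mem_add hM hW
  | succ l ih =>
    rintro M (h | ⟨A, hA, B, hB, t, ht, ⟨a, b, ha, hb, hab⟩, rfl⟩) W hW
    · exact Or.inl (ih M h W hW)
    have hb0 : b ≠ 0 := by
      rintro rfl
      simp at hb
    set P := Matrix.vecMulVec (fun i => a i) (fun j => b j) with hP
    set Q := Matrix.vecMulVec (fun i => b i) (fun j => a j) with hQ
    have hPQ : Pᵀ = Q := Matrix.transpose_vecMulVec _ _
    have hQP : Qᵀ = P := Matrix.transpose_vecMulVec _ _
    have hskew : ∀ c : ℝ, W + c • (P - Q) ∈ skewSet n := fun c => by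
      simp only [skewSet, mem_ofPred_eq] at hW ⊢
      rw [Matrix.transpose_add, Matrix.transpose_smul, Matrix.transpose_sub, hPQ, hQP, hW]
      module
    refine Or.inr ⟨_, ih A hA _ (hskew ((1 - t) / 2)), _, ih B hB _ (hskew (-t / 2)), t, ht, ?_, ?_⟩
    · refine Eq.trans (congrArg Matrix.rank ?_) (rank_vecMulVec_eq_one ha hb0)
      rw [← hP]
      have hA' : A = B + (1 / 2 : ℝ) • (P + Q) := by
        rw [← sub_eq_iff_eq_add']
        exact hab
      rw [hA']
      module
    · module

lemma lamHull_add_skewSet {n : ℕ} {K : Set (Mat n)} (hK : symLamHull K = convexHull ℝ K) :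
    convexHull ℝ (K + skewSet n) = lamHull (K + skewSet n) ∧
      lamHull (K + skewSet n) = symLamHull K + skewSet n := by
  have h1 : lamHull (K + skewSet n) ⊆ convexHull ℝ (K + skewSet n) :=
    iUnion_subset (lamSets_subset_convexHull _)
  have h2 : convexHull ℝ (K + skewSet n) = symLamHull K + skewSet n := by
    rw [convexHull_add, (convex_skewSet n).convexHull_eq, hK]
  have h3 : symLamHull K + skewSet n ⊆ lamHull (K + skewSet n) := by
    rintro _ ⟨M, hM, W, hW, rfl⟩
    obtain ⟨l, hl⟩ := mem_iUnion.mp hM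
    exact mem_iUnion.mpr ⟨l, add_mem_lamSets K l M hl W hW⟩
  exact ⟨(h2.trans_subset h3).antisymm h1, (h1.trans_eq h2).antisymm h3⟩

lemma pairwise_symCompat_Kh : Kh.Pairwise SymCompat := by
  have h3 : Real.sqrt 3 * Real.sqrt 3 = 3 := Real.mul_self_sqrt (by norm_num)
  have h0 : Real.sqrt 3 ≠ 0 := by positivity
  simp only [Kh, Set.pairwise_insert_of_symm, Set.pairwise_singleton,
    Set.forall_mem_insert, Set.mem_singleton_iff, forall_eq, true_and]
  refine ⟨fun _ => ?_, fun _ => ?_, fun _ => ?_⟩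
  · refine SymCompat.of_ne_zero (a := !₂[1, 0]) (b := !₂[0, 2 * Real.sqrt 3])
      (fun h => ?_) (fun h => ?_) ?_
    · simpa using congrArg (fun v : Euc 2 => v 0) h
    · simpa using congrArg (fun v : Euc 2 => v 1) h
    · ext i j
      fin_cases i <;> fin_cases j <;> simp [symProd] <;> ring
  · refine SymCompat.of_ne_zero (a := !₂[1, -Real.sqrt 3]) (b := !₂[3 / 2, Real.sqrt 3 / 2])
      (fun h => ?_) (fun h => ?_) ?_
    · simpa using congrArg (fun v : Euc 2 => v 0) h
    · simpa using congrArg (fun v : Euc 2 => v 0) h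
    · ext i j
      fin_cases i <;> fin_cases j <;> simp [symProd] <;> nlinarith
  · refine SymCompat.of_ne_zero (a := !₂[1, Real.sqrt 3]) (b := !₂[3 / 2, -Real.sqrt 3 / 2])
      (fun h => ?_) (fun h => ?_) ?_
    · simpa using congrArg (fun v : Euc 2 => v 0) h
    · simpa using congrArg (fun v : Euc 2 => v 0) h
    · ext i j
      fin_cases i <;> fin_cases j <;> simp [symProd] <;> nlinarith

lemma symCompat_of_entries {A B : Mat 3} {a₀ a₁ a₂ b₀ b₁ b₂ : ℝ}
    (ha : a₀ ≠ 0 ∨ a₁ ≠ 0 ∨ a₂ ≠ 0) (hb : b₀ ≠ 0 ∨ b₁ ≠ 0 ∨ b₂ ≠ 0)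
    (h : A - B = !![a₀ * b₀, (a₀ * b₁ + b₀ * a₁) / 2, (a₀ * b₂ + b₀ * a₂) / 2;
      (a₀ * b₁ + b₀ * a₁) / 2, a₁ * b₁, (a₁ * b₂ + b₁ * a₂) / 2;
      (a₀ * b₂ + b₀ * a₂) / 2, (a₁ * b₂ + b₁ * a₂) / 2, a₂ * b₂]) : SymCompat A B := by
  have hne : ∀ {x y z : ℝ}, x ≠ 0 ∨ y ≠ 0 ∨ z ≠ 0 → (!₂[x, y, z] : Euc 3) ≠ 0 := by
    intro x y z hxyz h0
    have hx : x = 0 := by simpa using congrArg (fun v : Euc 3 => v 0) h0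
    have hy : y = 0 := by simpa using congrArg (fun v : Euc 3 => v 1) h0
    have hz : z = 0 := by simpa using congrArg (fun v : Euc 3 => v 2) h0
    tauto
  refine SymCompat.of_ne_zero (hne ha) (hne hb) (h.trans ?_)
  ext i j
  fin_cases i <;> fin_cases j <;> simp [symProd] <;> ring

lemma pairwise_symCompat_Kco {δ : ℝ} (hδ : 0 < δ) : (Kco δ).Pairwise SymCompat := by
  have h0 : δ ≠ 0 := hδ.ne'
  simp only [Kco, Set.pairwise_insert_of_symm, Set.pairwise_singleton,
    Set.forall_mem_insert, Set.mem_singleton_iff, forall_eq, true_and, and_assoc]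
  refine ⟨
    fun _ => symCompat_of_entries (a₀ := 0) (a₁ := 4 * δ) (a₂ := 0) (b₀ := 0) (b₁ := 0) (b₂ := 1)
      ?_ ?_ ?_,
    fun _ => symCompat_of_entries (a₀ := 3) (a₁ := -3) (a₂ := -2 * δ) (b₀ := 1) (b₁ := 1) (b₂ := 0)
      ?_ ?_ ?_,
    fun _ => symCompat_of_entries (a₀ := 3) (a₁ := 3) (a₂ := -2 * δ) (b₀ := 1) (b₁ := -1) (b₂ := 0)
      ?_ ?_ ?_,
    fun _ => symCompat_of_entries (a₀ := 4 * δ) (a₁ := 0) (a₂ := 0) (b₀ := 0) (b₁ := 0) (b₂ := 1)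
      ?_ ?_ ?_,
    fun _ => symCompat_of_entries (a₀ := 3) (a₁ := 3) (a₂ := 2 * δ) (b₀ := 1) (b₁ := -1) (b₂ := 0)
      ?_ ?_ ?_,
    fun _ => symCompat_of_entries (a₀ := 3) (a₁ := -3) (a₂ := 2 * δ) (b₀ := 1) (b₁ := 1) (b₂ := 0)
      ?_ ?_ ?_,
    fun _ => symCompat_of_entries (a₀ := -2 * δ) (a₁ := 3) (a₂ := -3) (b₀ := 0) (b₁ := 1) (b₂ := 1)
      ?_ ?_ ?_,
    fun _ => symCompat_of_entries (a₀ := -2 * δ) (a₁ := 3) (a₂ := 3) (b₀ := 0) (b₁ := 1) (b₂ := -1)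
      ?_ ?_ ?_,
    fun _ => symCompat_of_entries (a₀ := 3) (a₁ := -2 * δ) (a₂ := -3) (b₀ := 1) (b₁ := 0) (b₂ := 1)
      ?_ ?_ ?_,
    fun _ => symCompat_of_entries (a₀ := 3) (a₁ := -2 * δ) (a₂ := 3) (b₀ := 1) (b₁ := 0) (b₂ := -1)
      ?_ ?_ ?_,
    fun _ => symCompat_of_entries (a₀ := 4 * δ) (a₁ := 0) (a₂ := 0) (b₀ := 0) (b₁ := 1) (b₂ := 0)
      ?_ ?_ ?_,
    fun _ => symCompat_of_entries (a₀ := 2 * δ) (a₁ := 3) (a₂ := 3) (b₀ := 0) (b₁ := 1) (b₂ := -1)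
      ?_ ?_ ?_,
    fun _ => symCompat_of_entries (a₀ := 2 * δ) (a₁ := 3) (a₂ := -3) (b₀ := 0) (b₁ := 1) (b₂ := 1)
      ?_ ?_ ?_,
    fun _ => symCompat_of_entries (a₀ := 3) (a₁ := 2 * δ) (a₂ := 3) (b₀ := 1) (b₁ := 0) (b₂ := -1)
      ?_ ?_ ?_,
    fun _ => symCompat_of_entries (a₀ := 3) (a₁ := 2 * δ) (a₂ := -3) (b₀ := 1) (b₁ := 0) (b₂ := 1)
      ?_ ?_ ?_⟩
  all_goals first
    | (simp [h0]; done)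
    | (ext i j; fin_cases i <;> fin_cases j <;> simp <;> ring)

lemma finrank_vectorSpan_Kh : Module.finrank ℝ (vectorSpan ℝ Kh) = 2 := by
  have h0 : Real.sqrt 3 ≠ 0 := by positivity
  set p : Fin 3 → Mat 2 := ![!![(1 : ℝ), 0; 0, -1],
    !![(-1 : ℝ)/2, Real.sqrt 3 / 2; Real.sqrt 3 / 2, 1/2],
    !![(-1 : ℝ)/2, -(Real.sqrt 3) / 2; -(Real.sqrt 3) / 2, 1/2]] with hp
  have hr : Kh = Set.range p := by
    simp only [hp, Kh, Matrix.range_cons, Matrix.range_empty, Set.union_empty, Set.singleton_union]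
  have hi : AffineIndependent ℝ p := by
    rw [affineIndependent_iff_of_fintype]
    intro w hw hv
    rw [Finset.weightedVSub_eq_linear_combination _ hw] at hv
    have e00 := congrFun (congrFun hv 0) 0
    have e01 := congrFun (congrFun hv 0) 1
    simp [hp, Fin.sum_univ_succ] at hw e00 e01
    have e : w 1 = w 2 := by
      apply mul_right_cancel₀ h0
      linarith
    intro i
    fin_cases i <;> simp <;> linarith
  rw [hr, hi.finrank_vectorSpan (n := 2) (by simp)]

lemma finrank_vectorSpan_Kco {δ : ℝ} (hδ : 0 < δ) :
    Module.finrank ℝ (vectorSpan ℝ (Kco δ)) = 5 := by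
  have h0 : δ ≠ 0 := hδ.ne'
  set p : Fin 6 → Mat 3 := ![!![(1 : ℝ), δ, 0; δ, 1, 0; 0, 0, -2],
    !![(1 : ℝ), -δ, 0; -δ, 1, 0; 0, 0, -2],
    !![(1 : ℝ), 0, δ; 0, -2, 0; δ, 0, 1],
    !![(1 : ℝ), 0, -δ; 0, -2, 0; -δ, 0, 1],
    !![(-2 : ℝ), 0, 0; 0, 1, δ; 0, δ, 1],
    !![(-2 : ℝ), 0, 0; 0, 1, -δ; 0, -δ, 1]] with hp
  have hr : Kco δ = Set.range p := by
    simp only [hp, Kco, Matrix.range_cons, Matrix.range_empty, Set.union_empty, Set.singleton_union]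
  have hi : AffineIndependent ℝ p := by
    rw [affineIndependent_iff_of_fintype]
    intro w hw hv
    rw [Finset.weightedVSub_eq_linear_combination _ hw] at hv
    have e00 := congrFun (congrFun hv 0) 0
    have e11 := congrFun (congrFun hv 1) 1
    have e01 := congrFun (congrFun hv 0) 1
    have e02 := congrFun (congrFun hv 0) 2
    have e12 := congrFun (congrFun hv 1) 2
    simp [hp, Fin.sum_univ_succ] at hw e00 e11 e01 e02 e12
    have f01 : w 0 = w 1 := mul_right_cancel₀ h0 (by linarith)
    have f23 : w 2 = w 3 := mul_right_cancel₀ h0 (by linarith)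
    have f45 : w 4 = w 5 := mul_right_cancel₀ h0 (by linarith)
    intro i
    fin_cases i <;> simp <;> linarith
  rw [hr, hi.finrank_vectorSpan (n := 5) (by simp)]

lemma vectorSpan_convexHull {E : Type*} [AddCommGroup E] [Module ℝ E] (s : Set E) :
    vectorSpan ℝ (convexHull ℝ s) = vectorSpan ℝ s := by
  rw [← direction_affineSpan, affineSpan_convexHull, direction_affineSpan]

lemma symLamHull_Kh : symLamHull Kh = convexHull ℝ Kh ∧ symLamHull Kh = symLamSets Kh 2 := by
  classical
  have hs : Kh = (({!![(1 : ℝ), 0; 0, -1],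
      !![(-1 : ℝ)/2, Real.sqrt 3 / 2; Real.sqrt 3 / 2, 1/2],
      !![(-1 : ℝ)/2, -(Real.sqrt 3) / 2; -(Real.sqrt 3) / 2, 1/2]} : Finset (Mat 2)) :
      Set (Mat 2)) := by
    simp [Kh]
  have hK := pairwise_symCompat_Kh
  rw [hs] at hK ⊢
  exact symLamHull_eq_of_pairwise _ hK 2 Finset.card_le_three

lemma symLamHull_Kco {δ : ℝ} (hδ : 0 < δ) : symLamHull (Kco δ) = convexHull ℝ (Kco δ) ∧
    symLamHull (Kco δ) = symLamSets (Kco δ) 5 := by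
  classical
  have hs : Kco δ = (({!![(1 : ℝ), δ, 0; δ, 1, 0; 0, 0, -2],
      !![(1 : ℝ), -δ, 0; -δ, 1, 0; 0, 0, -2],
      !![(1 : ℝ), 0, δ; 0, -2, 0; δ, 0, 1],
      !![(1 : ℝ), 0, -δ; 0, -2, 0; -δ, 0, 1],
      !![(-2 : ℝ), 0, 0; 0, 1, δ; 0, δ, 1],
      !![(-2 : ℝ), 0, 0; 0, 1, -δ; 0, -δ, 1]} : Finset (Mat 3)) : Set (Mat 3)) := by
    simp [Kco]
  have hK := pairwise_symCompat_Kco hδ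
  rw [hs] at hK ⊢
  exact symLamHull_eq_of_pairwise _ hK 5 Finset.card_le_six

/-- The symmetrized lamination convex hulls of the hexagonal-to-rhombic and
cubic-to-orthorhombic strains coincide with the convex hulls and are attained
after 2 resp. 5 symmetrized lamination steps; the affine dimensions are 2 resp. 5;
and for `K = K̃ + Skew(n)` one has `conv(K) = K^{lc} = K̃^{lc,sym} + Skew(n)`. -/
theorem hulls_hexagonal_and_cubic_orthorhombic (δ : ℝ) (hδ : 0 < δ) :
    (symLamHull Kh = convexHull ℝ Kh ∧ symLamHull Kh = symLamSets Kh 2 ∧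
     symLamHull (Kco δ) = convexHull ℝ (Kco δ) ∧
     symLamHull (Kco δ) = symLamSets (Kco δ) 5) ∧
    (Module.finrank ℝ (vectorSpan ℝ (convexHull ℝ Kh)) = 2 ∧
     Module.finrank ℝ (vectorSpan ℝ (convexHull ℝ (Kco δ))) = 5) ∧
    (convexHull ℝ (Kh + skewSet 2) = lamHull (Kh + skewSet 2) ∧
     lamHull (Kh + skewSet 2) = symLamHull Kh + skewSet 2 ∧
     convexHull ℝ (Kco δ + skewSet 3) = lamHull (Kco δ + skewSet 3) ∧
     lamHull (Kco δ + skewSet 3) = symLamHull (Kco δ) + skewSet 3) := by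
  have h1 := symLamHull_Kh
  have h2 := symLamHull_Kco hδ
  have h3 := lamHull_add_skewSet h1.1
  have h4 := lamHull_add_skewSet h2.1
  refine ⟨⟨h1.1, h1.2, h2.1, h2.2⟩, ⟨?_, ?_⟩, h3.1, h3.2, h4.1, h4.2⟩
  · rw [vectorSpan_convexHull, finrank_vectorSpan_Kh]
  · rw [vectorSpan_convexHull, finrank_vectorSpan_Kco hδ]
end
end
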